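/- Let h, ε > 0 be small enough, let u and f be as in Assumption 2.1 with f additionally differentiable, and let c_h : ℝ^d × ℝ^d → ℝ be continuous with y ↦ c_h(x,y) differentiable for each x, and satisfying 0 ≤ c_h(x,y) ≤ C(h)(‖x‖² + ‖y‖²), ‖x − y‖² ≤ C(c_h(x,y) + h²(‖x‖² + ‖y‖²)), and ‖∇_y c_h(x,y)‖ ≤ C(h)(‖x‖² + ‖y‖² + 1). Let μ ∈ 𝒫₂^r(ℝ^d) with 𝓕(μ) < ∞ and H(μ) < ∞, let ν be the minimiser over 𝒫₂^r(ℝ^d) of ν ↦ (1/2h) W_{c_h,ε}(μ,ν) + 𝓕(ν), and let γ ∈ Π^r(μ,ν) be the optimal coupling attaining W_{c_h,ε}(μ,ν). Then for every η ∈ C_c^∞(ℝ^d; ℝ^d): 0 = (1/2h) ∫_{ℝ^{2d}} ⟨η(y), ∇_y c_h(x,y)⟩ dγ(x,y) − (ε/2h) ∫_{ℝ^d} ν(y) div η(y) dy + ∫_{ℝ^d} ν(y) ⟨η(y), ∇f(y)⟩ dy − ∫_{ℝ^d} p(ν(y)) div η(y) dy, where p(s) := u'(s)s − u(s). -/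

import Mathlib

open MeasureTheory Filter
open scoped ENNReal NNReal RealInnerProductSpace Topology Classical

noncomputable section

/-- `ℝ^d` with the Euclidean norm. -/
abbrev Euc (d : ℕ) : Type := EuclideanSpace ℝ (Fin d)

/-- Second moment `M(ρ) = ∫ ‖x‖² dρ`. -/
def M2 {α : Type*} [NormedAddCommGroup α] [MeasurableSpace α] (ρ : Measure α) : ℝ≥0∞ :=
  ∫⁻ x, (‖x‖₊ : ℝ≥0∞) ^ 2 ∂ρ

/-- `𝒫₂`: probability measures with finite second moment. -/
def IsP2 {α : Type*} [NormedAddCommGroup α] [MeasurableSpace α] (ρ : Measure α) : Prop :=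
  IsProbabilityMeasure ρ ∧ M2 ρ < ⊤

/-- the density of a measure w.r.t. the reference (Lebesgue) measure. -/
def dens {α : Type*} [MeasureSpace α] (ρ : Measure α) (x : α) : ℝ :=
  (ρ.rnDeriv volume x).toReal

/-- `𝒫₂^r`: absolutely continuous members of `𝒫₂`. -/
def IsP2r {α : Type*} [NormedAddCommGroup α] [MeasureSpace α] (ρ : Measure α) : Prop :=
  IsP2 ρ ∧ ρ ≪ (volume : Measure α)

/-- (negative Boltzmann) entropy `H(ρ) = ∫ ρ log ρ` if `ρ` is absolutely continuous
(`+∞` otherwise). -/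
def entropy {α : Type*} [MeasureSpace α] (ρ : Measure α) : EReal :=
  if ρ ≪ (volume : Measure α) ∧
      Integrable (fun x => dens ρ x * Real.log (dens ρ x)) (volume : Measure α)
  then ((∫ x, dens ρ x * Real.log (dens ρ x) ∂(volume : Measure α) : ℝ) : EReal)
  else ⊤

/-- `γ` is a coupling (transport plan) between `μ` and `ν`. -/
def IsCoupling {α : Type*} [MeasurableSpace α] (γ : Measure (α × α)) (μ ν : Measure α) : Prop :=
  γ.fst = μ ∧ γ.snd = ν

/-- `(c, γ) = ∫ c dγ` for a nonnegative cost. -/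
def costInt {α : Type*} [MeasurableSpace α] (c : α × α → ℝ) (γ : Measure (α × α)) : ℝ≥0∞ :=
  ∫⁻ p, ENNReal.ofReal (c p) ∂γ

/-- entropic regularised optimal transport cost `W_{c,ε}`. -/
def transportCost {α : Type*} [MeasureSpace α] (c : α × α → ℝ) (ε : ℝ)
    (μ ν : Measure α) : EReal :=
  ⨅ γ ∈ {γ : Measure (α × α) | IsCoupling γ μ ν},
    ((costInt c γ : EReal) + (ε : EReal) * entropy γ)

/-- potential part of the free energy, `F(ρ) = ∫ f dρ` (`f ≥ 0`). -/
def potentialEnergy {α : Type*} [MeasurableSpace α] (f : α → ℝ) (ρ : Measure α) : EReal :=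
  ((∫⁻ x, ENNReal.ofReal (f x) ∂ρ : ℝ≥0∞) : EReal)

/-- internal part of the free energy, `U(ρ) = ∫ u(ρ(x)) dx` (`+∞` if not a.c.). -/
def internalEnergy {α : Type*} [MeasureSpace α] (u : ℝ → ℝ) (ρ : Measure α) : EReal :=
  if ρ ≪ (volume : Measure α) ∧ Integrable (fun x => u (dens ρ x)) (volume : Measure α)
  then ((∫ x, u (dens ρ x) ∂(volume : Measure α) : ℝ) : EReal)
  else ⊤

/-- free energy `𝓕(ρ) = ∫ f dρ + ∫ u(ρ) dx`. -/
def freeEnergy {α : Type*} [MeasureSpace α] (f : α → ℝ) (u : ℝ → ℝ) (ρ : Measure α) : EReal :=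
  potentialEnergy f ρ + internalEnergy u ρ

/-- the JKO functional `ν ↦ (1/2h) W_{c,ε}(μ,ν) + 𝓕(ν)`. -/
def JKO {α : Type*} [MeasureSpace α] (c : α × α → ℝ) (h ε : ℝ) (f : α → ℝ) (u : ℝ → ℝ)
    (μ ν : Measure α) : EReal :=
  ((1 / (2 * h) : ℝ) : EReal) * transportCost c ε μ ν + freeEnergy f u ν

/-- divergence of a vector field (trace of the Jacobian). -/
def divg {d : ℕ} (F : Euc d → Euc d) (x : Euc d) : ℝ :=
  LinearMap.trace ℝ (Euc d) (fderiv ℝ F x).toLinearMap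

/-- the pressure `p(s) = u'(s) s - u(s)`. -/
def press (u : ℝ → ℝ) (s : ℝ) : ℝ := deriv u s * s - u s

/-- weak convergence of measures (against bounded continuous functions). -/
def WeakTendsto {α : Type*} [TopologicalSpace α] [MeasurableSpace α]
    (μs : ℕ → Measure α) (μ : Measure α) : Prop :=
  ∀ g : BoundedContinuousFunction α ℝ,
    Tendsto (fun k => ∫ x, g x ∂(μs k)) atTop (nhds (∫ x, g x ∂μ))


/-- An internal energy density: convex on `[0,∞)`, `C²` on `(0,∞)`, vanishing at `0`. -/
structure EnergyDensity (u : ℝ → ℝ) : Prop where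
  convex : ConvexOn ℝ (Set.Ici 0) u
  smooth : ContDiffOn ℝ 2 u (Set.Ioi 0)
  zero : u 0 = 0

namespace EnergyDensity

variable {u : ℝ → ℝ}

theorem hasDerivAt (hu : EnergyDensity u) {s : ℝ} (hs : 0 < s) :
    HasDerivAt u (deriv u s) s :=
  ((hu.smooth.contDiffAt (Ioi_mem_nhds hs)).differentiableAt (by norm_num)).hasDerivAt

theorem contDiffOn_deriv (hu : EnergyDensity u) : ContDiffOn ℝ 1 (deriv u) (Set.Ioi 0) :=
  ((contDiffOn_succ_iff_deriv_of_isOpen (n := 1) isOpen_Ioi).1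
    (by simpa [one_add_one_eq_two] using hu.smooth)).2.2

theorem hasDerivAt_deriv (hu : EnergyDensity u) {s : ℝ} (hs : 0 < s) :
    HasDerivAt (deriv u) (deriv (deriv u) s) s :=
  ((hu.contDiffOn_deriv.contDiffAt (Ioi_mem_nhds hs)).differentiableAt (by norm_num)).hasDerivAt

theorem monotoneOn_deriv (hu : EnergyDensity u) : MonotoneOn (deriv u) (Set.Ioi 0) :=
  (hu.convex.subset Set.Ioi_subset_Ici_self (convex_Ioi 0)).monotoneOn_deriv
    fun _ hx => (hu.hasDerivAt hx).differentiableAt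

theorem deriv_deriv_nonneg (hu : EnergyDensity u) {s : ℝ} (hs : 0 < s) :
    0 ≤ deriv (deriv u) s := by
  rw [← derivWithin_of_isOpen isOpen_Ioi (Set.mem_Ioi.2 hs)]
  exact hu.monotoneOn_deriv.derivWithin_nonneg

theorem sub_le_deriv_mul (hu : EnergyDensity u) {s t : ℝ} (hs : 0 ≤ s) (ht : 0 < t) :
    u t - u s ≤ deriv u t * (t - s) := by
  rcases lt_trichotomy s t with h | h | h
  · have := hu.convex.slope_le_deriv (Set.mem_Ici.2 hs) (Set.mem_Ici.2 ht.le) h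
      (hu.hasDerivAt ht).differentiableAt
    rwa [slope_def_field, div_le_iff₀ (sub_pos.2 h)] at this
  · simp [h]
  · have := hu.convex.deriv_le_slope (Set.mem_Ici.2 ht.le) (Set.mem_Ici.2 hs) h
      (hu.hasDerivAt ht).differentiableAt
    rw [slope_def_field, le_div_iff₀ (sub_pos.2 h)] at this
    linarith

theorem press_nonneg (hu : EnergyDensity u) {s : ℝ} (hs : 0 ≤ s) : 0 ≤ press u s := by
  rcases hs.eq_or_lt with rfl | hs
  · simp [press, hu.zero]
  · have := hu.sub_le_deriv_mul le_rfl hs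
    rw [hu.zero] at this
    simp only [press]; linarith

theorem hasDerivAt_press (hu : EnergyDensity u) {s : ℝ} (hs : 0 < s) :
    HasDerivAt (press u) (deriv (deriv u) s * s) s := by
  have h := ((hu.hasDerivAt_deriv hs).mul (hasDerivAt_id s)).sub (hu.hasDerivAt hs)
  exact h.congr_deriv (by simp)

theorem measurable_comp (hu : EnergyDensity u) {α : Type*} [MeasurableSpace α] {n : α → ℝ}
    (hn : Measurable n) (hn0 : ∀ x, 0 ≤ n x) : Measurable fun x => u (n x) := by
  have h : Measurable ((Set.Ioi (0 : ℝ)).piecewise u fun _ => 0) :=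
    hu.smooth.continuousOn.measurable_piecewise continuousOn_const measurableSet_Ioi
  convert h.comp hn using 1
  ext x
  rcases (hn0 x).eq_or_lt with h0 | h0
  · simp [Set.piecewise, ← h0, hu.zero]
  · simp [Set.piecewise, h0]

theorem exists_bound (hu : EnergyDensity u) (R : ℝ) :
    ∃ B : ℝ, ∀ s, 0 ≤ s → s ≤ R → |u s| ≤ B := by
  refine ⟨|u (max R 0)| + (|u 1| + |deriv u 1| * (1 + max R 0)), fun s h0 hR => ?_⟩
  have hR' : s ≤ max R 0 := hR.trans (le_max_left _ _)
  have h1 := hu.sub_le_deriv_mul h0 one_pos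
  have h2 : u s ≤ |u (max R 0)| := by
    rcases h0.eq_or_lt with rfl | h0
    · simp [hu.zero]
    have hM : 0 < max R 0 := h0.trans_le hR'
    have hw : 0 ≤ s / max R 0 := by positivity
    have h := hu.convex.2 (Set.mem_Ici.2 le_rfl) (Set.mem_Ici.2 hM.le)
      (sub_nonneg.2 ((div_le_one hM).2 hR')) hw (by ring)
    simp only [smul_eq_mul, mul_zero, zero_add, hu.zero, div_mul_cancel₀ _ hM.ne'] at h
    refine h.trans ((mul_le_mul_of_nonneg_left (le_abs_self _) (by positivity)).trans ?_)
    exact mul_le_of_le_one_left (abs_nonneg _) ((div_le_one hM).2 hR')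
  have h3 : deriv u 1 * (1 - s) ≤ |deriv u 1| * (1 + max R 0) :=
    (le_abs_self _).trans <| by
      rw [abs_mul]
      gcongr
      rw [abs_le]; constructor <;> linarith
  have h4 := neg_abs_le (u 1)
  have h5 := abs_nonneg (u (max R 0))
  have h6 : 0 ≤ |u 1| + |deriv u 1| * (1 + max R 0) := by positivity
  rw [abs_le]; constructor <;> linarith

/-- `Ξ` is the inverse of `s ↦ τ log s + u' s`; the map `τ Ξ + p ∘ Ξ` is a primitive of `Ξ`. -/
theorem exists_inverse (hu : EnergyDensity u) {τ : ℝ} (hτ : 0 < τ) :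
    ∃ Ξ : ℝ → ℝ, (∀ r, 0 < Ξ r) ∧ (∀ s, 0 < s → Ξ (τ * Real.log s + deriv u s) = s) ∧
      (∀ r, τ * Real.log (Ξ r) + deriv u (Ξ r) = r) ∧
      Continuous Ξ ∧ Monotone Ξ ∧
      ∀ r, HasDerivAt (fun r => τ * Ξ r + press u (Ξ r)) (Ξ r) r := by
  set θ : ℝ → ℝ := fun v => τ * v + deriv u (Real.exp v) with hθ
  have hmono : Monotone fun v => deriv u (Real.exp v) := fun a b hab =>
    hu.monotoneOn_deriv (Real.exp_pos a) (Real.exp_pos b) (Real.exp_le_exp.2 hab)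
  have hd : ∀ v, HasDerivAt θ (τ + deriv (deriv u) (Real.exp v) * Real.exp v) v := fun v => by
    have h1 := (hu.hasDerivAt_deriv (Real.exp_pos v)).comp v (Real.hasDerivAt_exp v)
    have h2 := (hasDerivAt_id v).const_mul τ
    exact (h2.add h1).congr_deriv (by simp)
  have hstrict : StrictMono θ := fun a b hab => by
    have := hmono hab.le
    have := mul_lt_mul_of_pos_left hab hτ
    simp only [hθ] at *; linarith
  have hcont : Continuous θ := continuous_iff_continuousAt.2 fun v => (hd v).continuousAt
  have htop : Tendsto θ atTop atTop := by
    refine tendsto_atTop_mono' _ (f₁ := fun v => τ * v + deriv u (Real.exp 0)) ?_ ?_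
    · filter_upwards [eventually_ge_atTop 0] with v hv
      have := hmono hv
      simp only [hθ] at *; linarith
    · exact tendsto_atTop_add_const_right _ _ (tendsto_id.const_mul_atTop hτ)
  have hbot : Tendsto θ atBot atBot := by
    refine tendsto_atBot_mono' _ (f₁ := fun v => τ * v + deriv u (Real.exp 0)) ?_ ?_
    · filter_upwards [eventually_le_atBot 0] with v hv
      have := hmono hv
      simp only [hθ] at *; linarith
    · exact tendsto_atBot_add_const_right _ _ (tendsto_id.const_mul_atBot hτ)
  let e := hstrict.orderIsoOfSurjective θ (hcont.surjective htop hbot)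
  have he : ∀ v, e v = θ v := fun _ => rfl
  have hθe : ∀ r, θ (e.symm r) = r := fun r => e.apply_symm_apply r
  have hce : Continuous e.symm := e.symm.continuous
  refine ⟨fun r => Real.exp (e.symm r), fun r => Real.exp_pos _, fun s hs => ?_, fun r => ?_,
    Real.continuous_exp.comp hce, fun a b hab => Real.exp_le_exp.2 (e.symm.monotone hab),
    fun r => ?_⟩
  · have : τ * Real.log s + deriv u s = e (Real.log s) := by
      rw [he]; simp only [hθ, Real.exp_log hs]
    simp only [this, OrderIso.symm_apply_apply, Real.exp_log hs]
  · have := hθe r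
    simp only [hθ] at this
    simpa using this
  · have hpos : 0 < τ + deriv (deriv u) (Real.exp (e.symm r)) * Real.exp (e.symm r) :=
      add_pos_of_pos_of_nonneg hτ
        (mul_nonneg (hu.deriv_deriv_nonneg (Real.exp_pos _)) (Real.exp_pos _).le)
    have h1 : HasDerivAt e.symm _ r := HasDerivAt.of_local_left_inverse hce.continuousAt
      (hd (e.symm r)) hpos.ne' (Eventually.of_forall hθe)
    have h2 := h1.exp
    have h3 := (h2.const_mul τ).add 
      (HasDerivAt.comp (h := fun r => Real.exp (e.symm r)) r (hu.hasDerivAt_press (Real.exp_pos _)) h2)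
    refine h3.congr_deriv ?_
    have hne := hpos.ne'
    rw [mul_comm (deriv _ _)] at hne ⊢
    field_simp

end EnergyDensity


section Densities

variable {d : ℕ}

/-- Density of the first marginal. -/
def fstMarginal (g : Euc d × Euc d → ℝ) (x : Euc d) : ℝ := ∫ y, g (x, y)

/-- Density of the second marginal. -/
def sndMarginal (g : Euc d × Euc d → ℝ) (y : Euc d) : ℝ := ∫ x, g (x, y)

/-- Densities of plans with finite second moment, entropy and internal energy. -/
structure Admissible (u : ℝ → ℝ) (g : Euc d × Euc d → ℝ) : Prop where
  meas : Measurable g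
  nonneg : ∀ q, 0 ≤ g q
  integrable : Integrable g
  moment : Integrable fun q => (‖q.1‖ ^ 2 + ‖q.2‖ ^ 2) * g q
  entropy : Integrable fun q => g q * Real.log (g q)
  internal : Integrable fun y => u (sndMarginal g y)

/-- The JKO functional on densities of plans. -/
def planEnergy (b : Euc d × Euc d → ℝ) (τ : ℝ) (u : ℝ → ℝ) (g : Euc d × Euc d → ℝ) : ℝ :=
  (∫ q, b q * g q) + τ * (∫ q, g q * Real.log (g q)) + ∫ y, u (sndMarginal g y)

/-- `g` minimises the energy among admissible plans with the same first marginal. -/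
structure IsMinPlan (b : Euc d × Euc d → ℝ) (τ : ℝ) (u : ℝ → ℝ)
    (g : Euc d × Euc d → ℝ) : Prop where
  adm : Admissible u g
  min : ∀ g', Admissible u g' → (∀ᵐ x, fstMarginal g' x = fstMarginal g x) →
    planEnergy b τ u g ≤ planEnergy b τ u g'

/-- A cost with quadratic growth, differentiable in the second variable with gradient of
quadratic growth. -/
structure QuadraticCost (b : Euc d × Euc d → ℝ) (K : ℝ) : Prop where
  cont : Continuous b
  nonneg : ∀ q, 0 ≤ b q
  le : ∀ q, b q ≤ K * (‖q.1‖ ^ 2 + ‖q.2‖ ^ 2 + 1)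
  diff : ∀ x, Differentiable ℝ fun y => b (x, y)
  norm_fderiv_le : ∀ x y, ‖fderiv ℝ (fun y' => b (x, y')) y‖ ≤ K * (‖x‖ ^ 2 + ‖y‖ ^ 2 + 1)
  pos : 0 < K

/-- Bounded perturbations preserving the first marginal, supported where `g` and its second
marginal are bounded. -/
structure Perturbation (N : ℝ) (g Ψ : Euc d × Euc d → ℝ) : Prop where
  meas : Measurable Ψ
  bdd : ∃ B, 0 ≤ B ∧ ∀ q, |Ψ q| ≤ B
  supp : ∀ q, Ψ q ≠ 0 → ‖q.1‖ ≤ N ∧ ‖q.2‖ ≤ N ∧ g q ≤ N ∧ sndMarginal g q.2 ≤ N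
  marginal : ∀ x, ∫ y, Ψ (x, y) = 0

theorem integrable_of_bounded_support {α : Type*} [NormedAddCommGroup α] [ProperSpace α]
    [MeasurableSpace α] [OpensMeasurableSpace α] {μ : Measure α} [IsFiniteMeasureOnCompacts μ]
    {F : α → ℝ} (hF : AEStronglyMeasurable F μ) {N B : ℝ} (hB : ∀ᵐ q ∂μ, |F q| ≤ B)
    (hN : ∀ᵐ q ∂μ, F q ≠ 0 → ‖q‖ ≤ N) : Integrable F μ := by
  have h : IntegrableOn F (Metric.closedBall 0 N) μ :=
    Measure.integrableOn_of_bounded (M := B)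
      (isCompact_closedBall (0 : α) N).measure_lt_top.ne hF (ae_restrict_of_ae hB)
  rw [← integrable_indicator_iff Metric.isClosed_closedBall.measurableSet] at h
  refine h.congr ?_
  filter_upwards [hN] with q hq
  by_cases h0 : F q = 0
  · simp [Set.indicator, h0]
  · rw [Set.indicator_of_mem (by simpa using hq h0)]

theorem QuadraticCost.integrable_mul {b : Euc d × Euc d → ℝ} {K : ℝ} (hb : QuadraticCost b K)
    {u : ℝ → ℝ} {g : Euc d × Euc d → ℝ} (hg : Admissible u g) :
    Integrable fun q => b q * g q := by
  refine ((hg.moment.add hg.integrable).const_mul K).mono'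
    (hb.cont.measurable.mul hg.meas).aestronglyMeasurable (Eventually.of_forall fun q => ?_)
  rw [Real.norm_eq_abs, abs_of_nonneg (mul_nonneg (hb.nonneg q) (hg.nonneg q))]
  have := mul_le_mul_of_nonneg_right (hb.le q) (hg.nonneg q)
  simp only [Pi.add_apply]; linarith

theorem sndMarginal_nonneg {g : Euc d × Euc d → ℝ} (hg : ∀ q, 0 ≤ g q) (y : Euc d) :
    0 ≤ sndMarginal g y := integral_nonneg fun _ => hg _

theorem measurable_sndMarginal {g : Euc d × Euc d → ℝ} (hg : Measurable g) :
    Measurable (sndMarginal g) := (hg.stronglyMeasurable.integral_prod_left').measurable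

theorem fstMarginal_nonneg {g : Euc d × Euc d → ℝ} (hg : ∀ q, 0 ≤ g q) (x : Euc d) :
    0 ≤ fstMarginal g x := integral_nonneg fun _ => hg _

theorem measurable_fstMarginal {g : Euc d × Euc d → ℝ} (hg : Measurable g) :
    Measurable (fstMarginal g) := (hg.stronglyMeasurable.integral_prod_right').measurable

theorem ae_integrable_left {g : Euc d × Euc d → ℝ} (hg : Integrable g) :
    ∀ᵐ y, Integrable fun x => g (x, y) :=
  ((integrable_prod_iff' (μ := volume) (ν := volume) hg.1).1 hg).1

theorem ae_integrable_right {g : Euc d × Euc d → ℝ} (hg : Integrable g) :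
    ∀ᵐ x, Integrable fun y => g (x, y) :=
  ((integrable_prod_iff (μ := volume) (ν := volume) hg.1).1 hg).1

theorem integral_fstMarginal {g : Euc d × Euc d → ℝ} (hg : Integrable g) :
    ∫ x, fstMarginal g x = ∫ q, g q := (integral_prod _ hg).symm

theorem integral_sndMarginal {g : Euc d × Euc d → ℝ} (hg : Integrable g) :
    ∫ y, sndMarginal g y = ∫ q, g q := (integral_prod_symm _ hg).symm

theorem integrable_sndMarginal {g : Euc d × Euc d → ℝ} (hg : Integrable g) :
    Integrable (sndMarginal g) := hg.integral_prod_right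

theorem integrable_fstMarginal {g : Euc d × Euc d → ℝ} (hg : Integrable g) :
    Integrable (fstMarginal g) := hg.integral_prod_left

namespace Perturbation

variable {N : ℝ} {g Ψ : Euc d × Euc d → ℝ}

theorem const_mul (h : Perturbation N g Ψ) (s : ℝ) : Perturbation N g fun q => s * Ψ q where
  meas := h.meas.const_mul s
  bdd := by
    obtain ⟨B, hB, h⟩ := h.bdd
    exact ⟨|s| * B, by positivity, fun q => by rw [abs_mul]; gcongr; exact h q⟩
  supp q hq := h.supp q (right_ne_zero_of_mul hq)
  marginal x := by rw [integral_const_mul, h.marginal, mul_zero]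

theorem integrable_of_ne_zero (h : Perturbation N g Ψ) {F : Euc d × Euc d → ℝ}
    (hF : Measurable F) {B : ℝ} (hB : ∀ q, |F q| ≤ B) (h0 : ∀ q, Ψ q = 0 → F q = 0) :
    Integrable F :=
  integrable_of_bounded_support (N := N) hF.aestronglyMeasurable (Eventually.of_forall hB)
    (Eventually.of_forall fun q hq => by
      have := h.supp q (fun h' => hq (h0 q h'))
      exact max_le this.1 this.2.1)

theorem integrable (h : Perturbation N g Ψ) : Integrable Ψ :=
  have ⟨_, _, hB⟩ := h.bdd
  h.integrable_of_ne_zero h.meas hB fun _ => id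

theorem integrable_left (h : Perturbation N g Ψ) (y : Euc d) : Integrable fun x => Ψ (x, y) :=
  have ⟨_, _, hB⟩ := h.bdd
  integrable_of_bounded_support (N := N) (h.meas.comp (by fun_prop)).aestronglyMeasurable
    (Eventually.of_forall fun x => hB (x, y)) (Eventually.of_forall fun x hx => (h.supp _ hx).1)

theorem integrable_right (h : Perturbation N g Ψ) (x : Euc d) : Integrable fun y => Ψ (x, y) :=
  have ⟨_, _, hB⟩ := h.bdd
  integrable_of_bounded_support (N := N) (h.meas.comp (by fun_prop)).aestronglyMeasurable
    (Eventually.of_forall fun y => hB (x, y)) (Eventually.of_forall fun x hx => (h.supp _ hx).2.1)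

theorem sndMarginal_eq_zero (h : Perturbation N g Ψ) {y : Euc d}
    (hy : ¬(‖y‖ ≤ N ∧ sndMarginal g y ≤ N)) : sndMarginal Ψ y = 0 := by
  have : ∀ x, Ψ (x, y) = 0 := fun x => by
    by_contra h0
    exact hy ⟨(h.supp _ h0).2.1, (h.supp _ h0).2.2.2⟩
  simp [sndMarginal, this]

theorem exists_sndMarginal_le (h : Perturbation N g Ψ) :
    ∃ B, 0 ≤ B ∧ ∀ y, |sndMarginal Ψ y| ≤ B := by
  obtain ⟨B, hB0, hB⟩ := h.bdd
  refine ⟨B * (volume (Metric.closedBall (0 : Euc d) N)).toReal, by positivity, fun y => ?_⟩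
  have h1 : sndMarginal Ψ y = ∫ x in Metric.closedBall (0 : Euc d) N, Ψ (x, y) := by
    refine (setIntegral_eq_integral_of_forall_compl_eq_zero fun x hx => ?_).symm
    by_contra h0
    exact hx (by simpa using (h.supp _ h0).1)
  rw [h1]
  exact norm_setIntegral_le_of_norm_le_const (f := fun x => Ψ (x, y))
    (isCompact_closedBall (0 : Euc d) N).measure_lt_top fun x _ => hB (x, y)

theorem sndMarginal_add (h : Perturbation N g Ψ) (hg : Integrable g) :
    ∀ᵐ y, sndMarginal (fun q => g q + Ψ q) y = sndMarginal g y + sndMarginal Ψ y := by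
  filter_upwards [ae_integrable_left hg] with y hy
  exact integral_add hy (h.integrable_left y)

theorem fstMarginal_add (h : Perturbation N g Ψ) (hg : Integrable g) :
    ∀ᵐ x, fstMarginal (fun q => g q + Ψ q) x = fstMarginal g x := by
  filter_upwards [ae_integrable_right hg] with x hx
  rw [fstMarginal, integral_add hx (h.integrable_right x), h.marginal, add_zero]
  rfl

variable {u : ℝ → ℝ}

theorem integrable_entropy_sub (h : Perturbation N g Ψ) (hg : Admissible u g)
    (hpos : ∀ q, 0 ≤ g q + Ψ q) :
    Integrable fun q => (g q + Ψ q) * Real.log (g q + Ψ q) - g q * Real.log (g q) := by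
  obtain ⟨B, hB0, hB⟩ := h.bdd
  obtain ⟨M, hM⟩ := ((isCompact_Icc (a := (0 : ℝ)) (b := N + B)).exists_bound_of_continuousOn
    Real.continuous_mul_log.continuousOn)
  have hm := hg.meas.add h.meas
  have hmeas : Measurable fun q =>
      (g q + Ψ q) * Real.log (g q + Ψ q) - g q * Real.log (g q) :=
    (hm.mul (Real.measurable_log.comp hm)).sub
      (hg.meas.mul (Real.measurable_log.comp hg.meas))
  refine h.integrable_of_ne_zero (B := |M| + |M|) hmeas (fun q => ?_) fun q hq => by simp [hq]
  by_cases hq : Ψ q = 0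
  · simp [hq, ← two_mul]
  have h1 := (h.supp q hq).2.2.1
  have h2 := (abs_le.1 (hB q)).2
  refine (abs_sub _ _).trans (add_le_add ?_ ?_)
  · exact (hM _ ⟨hpos q, by linarith⟩).trans (le_abs_self M)
  · exact (hM _ ⟨hg.nonneg q, by linarith⟩).trans (le_abs_self M)

theorem integrable_internal_sub (h : Perturbation N g Ψ) (hu : EnergyDensity u)
    (hg : Admissible u g) (hpos : ∀ q, 0 ≤ g q + Ψ q) :
    Integrable fun y => u (sndMarginal (fun q => g q + Ψ q) y) - u (sndMarginal g y) := by
  obtain ⟨B, hB0, hB⟩ := h.exists_sndMarginal_le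
  obtain ⟨M, hM⟩ := hu.exists_bound (N + B)
  refine integrable_of_bounded_support (N := N) (B := |M| + |M|) ?_ ?_ ?_
  · exact ((hu.measurable_comp (measurable_sndMarginal (hg.meas.add h.meas))
      (sndMarginal_nonneg hpos)).sub (hu.measurable_comp (measurable_sndMarginal hg.meas)
      (sndMarginal_nonneg hg.nonneg))).aestronglyMeasurable
  · filter_upwards [h.sndMarginal_add hg.integrable] with y hy
    by_cases hN : ‖y‖ ≤ N ∧ sndMarginal g y ≤ N
    · have h2 := (abs_le.1 (hB y)).2
      refine (abs_sub _ _).trans (add_le_add ?_ ?_)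
      · exact (hM _ (sndMarginal_nonneg hpos y) (by linarith)).trans (le_abs_self M)
      · exact (hM _ (sndMarginal_nonneg hg.nonneg y) (by linarith)).trans (le_abs_self M)
    · rw [hy, h.sndMarginal_eq_zero hN, add_zero, sub_self, abs_zero]
      positivity
  · filter_upwards [h.sndMarginal_add hg.integrable] with y hy h0
    by_contra hN
    rw [hy, h.sndMarginal_eq_zero (fun h' => hN h'.1), add_zero, sub_self] at h0
    exact h0 rfl

theorem integrable_mul_continuous (h : Perturbation N g Ψ) {b : Euc d × Euc d → ℝ}
    (hb : Continuous b) : Integrable fun q => b q * Ψ q := by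
  obtain ⟨B, hB0, hB⟩ := h.bdd
  obtain ⟨M, hM⟩ := ((isCompact_closedBall (0 : Euc d × Euc d) N).exists_bound_of_continuousOn
    hb.continuousOn)
  refine h.integrable_of_ne_zero (B := |M| * B) (hb.measurable.mul h.meas) (fun q => ?_)
    fun q hq => by simp [hq]
  by_cases hq : Ψ q = 0
  · simp only [hq, mul_zero, abs_zero]; positivity
  rw [abs_mul]
  have hqN := h.supp q hq
  have hbq : |b q| ≤ |M| :=
    (hM q (mem_closedBall_zero_iff.2 (max_le hqN.1 hqN.2.1))).trans (le_abs_self M)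
  exact mul_le_mul hbq (hB q) (abs_nonneg _) (abs_nonneg _)

theorem admissible_add (h : Perturbation N g Ψ) (hu : EnergyDensity u)
    (hg : Admissible u g) (hpos : ∀ q, 0 ≤ g q + Ψ q) : Admissible u fun q => g q + Ψ q where
  meas := hg.meas.add h.meas
  nonneg := hpos
  integrable := hg.integrable.add h.integrable
  moment := by
    have := hg.moment.add (h.integrable_mul_continuous
      (b := fun q => ‖q.1‖ ^ 2 + ‖q.2‖ ^ 2) (by fun_prop))
    refine this.congr (Eventually.of_forall fun q => ?_)
    simp only [Pi.add_apply]; ring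
  entropy := by
    refine (hg.entropy.add (h.integrable_entropy_sub hg hpos)).congr
      (Eventually.of_forall fun q => ?_)
    simp only [Pi.add_apply]; ring
  internal := by
    refine (hg.internal.add (h.integrable_internal_sub hu hg hpos)).congr
      (Eventually.of_forall fun q => ?_)
    simp only [Pi.add_apply]; ring

theorem energy_variation_nonneg (h : Perturbation N g Ψ) (hu : EnergyDensity u)
    {b : Euc d × Euc d → ℝ} {K τ : ℝ} (hb : QuadraticCost b K) (hg : IsMinPlan b τ u g)
    (hpos : ∀ q, 0 ≤ g q + Ψ q) :
    0 ≤ (∫ q, b q * Ψ q) +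
      τ * (∫ q, ((g q + Ψ q) * Real.log (g q + Ψ q) - g q * Real.log (g q))) +
      ∫ y, (u (sndMarginal (fun q => g q + Ψ q) y) - u (sndMarginal g y)) := by
  have ha := h.admissible_add hu hg.adm hpos
  have hmin := hg.min _ ha (h.fstMarginal_add hg.adm.integrable)
  rw [integral_sub ha.entropy hg.adm.entropy, integral_sub ha.internal hg.adm.internal]
  have h1 : ∫ q, b q * (g q + Ψ q) = (∫ q, b q * g q) + ∫ q, b q * Ψ q := by
    rw [← integral_add (hb.integrable_mul hg.adm) (h.integrable_mul_continuous hb.cont)]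
    simp only [mul_add]
  simp only [planEnergy] at hmin
  rw [h1] at hmin
  linarith

end Perturbation

end Densities


section Variations

theorem energyDensity_mul_log : EnergyDensity fun s => s * Real.log s where
  convex := Real.convexOn_mul_log
  smooth := contDiffOn_id.mul (Real.contDiffOn_log.mono fun _ hx => (Set.mem_Ioi.1 hx).ne')
  zero := by simp

theorem EnergyDensity.abs_deriv_le {v : ℝ → ℝ} (hv : EnergyDensity v) {a c s : ℝ} (ha : 0 < a)
    (hs : a ≤ s) (hc : s ≤ c) : |deriv v s| ≤ |deriv v a| + |deriv v c| := by
  have h1 := hv.monotoneOn_deriv (Set.mem_Ioi.2 ha) (Set.mem_Ioi.2 (ha.trans_le hs)) hs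
  have h2 := hv.monotoneOn_deriv (Set.mem_Ioi.2 (ha.trans_le hs))
    (Set.mem_Ioi.2 ((ha.trans_le hs).trans_le hc)) hc
  have h3 := neg_abs_le (deriv v a)
  have h4 := le_abs_self (deriv v c)
  have h5 := abs_nonneg (deriv v a)
  have h6 := abs_nonneg (deriv v c)
  rw [abs_le]; constructor <;> linarith

theorem EnergyDensity.eventually_integral_sub_le {v : ℝ → ℝ} (hv : EnergyDensity v)
    {X : Type*} [NormedAddCommGroup X] [ProperSpace X] [MeasurableSpace X]
    [OpensMeasurableSpace X] {μ : Measure X} [IsFiniteMeasureOnCompacts μ] {a ψ : X → ℝ}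
    (ha : Measurable a) (hψ : Measurable ψ) (ha0 : ∀ x, 0 ≤ a x) {N B : ℝ} (hN : 0 < N)
    (hB : ∀ x, |ψ x| ≤ B) (hsupp : ∀ x, ψ x ≠ 0 → ‖x‖ ≤ N ∧ N⁻¹ ≤ a x ∧ a x ≤ N)
    {e : ℝ} (he : 0 < e) :
    ∀ᶠ s in 𝓝[>] (0 : ℝ),
      ∫ x, (v (a x + s * ψ x) - v (a x)) ∂μ ≤ s * ((∫ x, deriv v (a x) * ψ x ∂μ) + e) := by
  rcases isEmpty_or_nonempty X with hX | ⟨⟨x₀⟩⟩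
  · filter_upwards [self_mem_nhdsWithin] with s hs
    have : 0 ≤ s * e := mul_nonneg (le_of_lt hs) he.le
    simpa [Measure.eq_zero_of_isEmpty μ] using this
  have hB0 : 0 ≤ B := (abs_nonneg _).trans (hB x₀)
  set s₀ := (2 * N * (B + 1))⁻¹ with hs₀
  have hs₀pos : 0 < s₀ := by positivity
  set δ := N⁻¹ / 2 with hδ
  have hδpos : 0 < δ := by positivity
  have key : ∀ s, 0 < s → s ≤ s₀ → ∀ x, ψ x ≠ 0 →
      δ ≤ a x + s * ψ x ∧ a x + s * ψ x ≤ N + δ := by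
    intro s hs hs' x hx
    obtain ⟨-, h1, h2⟩ := hsupp x hx
    have h3 : |s * ψ x| ≤ δ := by
      rw [abs_mul, abs_of_pos hs]
      calc s * |ψ x| ≤ s₀ * (B + 1) := by
            gcongr
            linarith [hB x]
        _ = δ := by rw [hs₀, hδ]; field_simp
    have h4 := abs_le.1 h3
    constructor <;> linarith
  set D := |deriv v δ| + |deriv v (N + δ)| with hD
  have hmeas : ∀ s : ℝ, Measurable fun x => deriv v (a x + s * ψ x) * ψ x := fun s =>
    ((measurable_deriv v).comp (ha.add (hψ.const_mul s))).mul hψ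
  have hderiv : ∀ s, 0 < s → s ≤ s₀ → ∀ x, |deriv v (a x + s * ψ x) * ψ x| ≤ D * B := by
    intro s hs hs' x
    by_cases hx : ψ x = 0
    · simp only [hx, mul_zero, abs_zero]; positivity
    · rw [abs_mul]
      have := key s hs hs' x hx
      exact mul_le_mul (hv.abs_deriv_le hδpos this.1 this.2) (hB x) (abs_nonneg _) (by positivity)
  have hint : ∀ s, 0 < s → s ≤ s₀ → Integrable (fun x => deriv v (a x + s * ψ x) * ψ x) μ :=
    fun s hs hs' => integrable_of_bounded_support (hmeas s).aestronglyMeasurable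
      (Eventually.of_forall (hderiv s hs hs'))
      (Eventually.of_forall fun x hx => (hsupp x (right_ne_zero_of_mul hx)).1)
  obtain ⟨M, hM⟩ := hv.exists_bound (N + δ)
  have hnonneg : ∀ s, 0 < s → s ≤ s₀ → ∀ x, 0 ≤ a x + s * ψ x := fun s hs hs' x => by
    by_cases hx : ψ x = 0
    · simpa [hx] using ha0 x
    · exact hδpos.le.trans (key s hs hs' x hx).1
  have hint' : ∀ s, 0 < s → s ≤ s₀ → Integrable (fun x => v (a x + s * ψ x) - v (a x)) μ := by
    intro s hs hs'
    refine integrable_of_bounded_support (B := |M| + |M|) (N := N) ?_ ?_ ?_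
    · exact ((hv.measurable_comp (ha.add (hψ.const_mul s)) (hnonneg s hs hs')).sub
        (hv.measurable_comp ha ha0)).aestronglyMeasurable
    · refine Eventually.of_forall fun x => ?_
      by_cases hx : ψ x = 0
      · simp only [hx, mul_zero, add_zero, sub_self, abs_zero]; positivity
      · refine (abs_sub _ _).trans (add_le_add ?_ ?_)
        · exact (hM _ (hnonneg s hs hs' x) (key s hs hs' x hx).2).trans (le_abs_self M)
        · exact (hM _ (ha0 x) (by linarith [(hsupp x hx).2.2])).trans (le_abs_self M)
    · refine Eventually.of_forall fun x hx => (hsupp x fun h0 => hx (by simp [h0])).1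
  have hlim : Tendsto (fun s => ∫ x, deriv v (a x + s * ψ x) * ψ x ∂μ) (𝓝[>] (0 : ℝ))
      (𝓝 (∫ x, deriv v (a x) * ψ x ∂μ)) := by
    refine tendsto_integral_filter_of_dominated_convergence
      ((Metric.closedBall (0 : X) N).indicator fun _ => D * B)
      (Eventually.of_forall fun s => (hmeas s).aestronglyMeasurable) ?_ ?_ ?_
    · filter_upwards [Ioc_mem_nhdsGT hs₀pos] with s hs
      refine Eventually.of_forall fun x => ?_
      by_cases hx : ψ x = 0
      · simp only [hx, mul_zero, norm_zero]
        exact Set.indicator_nonneg (fun _ _ => by positivity) _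
      · rw [Set.indicator_of_mem (by simpa using (hsupp x hx).1)]
        exact hderiv s hs.1 hs.2 x
    · rw [integrable_indicator_iff Metric.isClosed_closedBall.measurableSet]
      exact integrableOn_const (isCompact_closedBall (0 : X) N).measure_lt_top.ne
    · refine Eventually.of_forall fun x => ?_
      by_cases hx : ψ x = 0
      · simp [hx]
      refine Tendsto.mul_const _ ?_
      have hax : 0 < a x := (inv_pos.2 hN).trans_le (hsupp x hx).2.1
      have hc : ContinuousAt (fun s => deriv v (a x + s * ψ x)) 0 := by
        refine ContinuousAt.comp (g := deriv v) ?_ (by fun_prop)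
        simpa using (hv.hasDerivAt_deriv hax).continuousAt
      simpa [ContinuousAt] using hc.mono_left nhdsWithin_le_nhds
  filter_upwards [Ioc_mem_nhdsGT hs₀pos, hlim.eventually (gt_mem_nhds (lt_add_of_pos_right _ he))]
    with s hs hlt
  calc ∫ x, (v (a x + s * ψ x) - v (a x)) ∂μ
      ≤ ∫ x, s * (deriv v (a x + s * ψ x) * ψ x) ∂μ := by
        refine integral_mono (hint' s hs.1 hs.2) ((hint s hs.1 hs.2).const_mul s) fun x => ?_
        by_cases hx : ψ x = 0
        · simp [hx]
        have := hv.sub_le_deriv_mul (ha0 x) (hδpos.trans_le (key s hs.1 hs.2 x hx).1)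
        simp only; linarith
    _ = s * ∫ x, deriv v (a x + s * ψ x) * ψ x ∂μ := integral_const_mul _ _
    _ ≤ _ := mul_le_mul_of_nonneg_left hlt.le hs.1.le

variable {d : ℕ}

/-- The region where `g` and its second marginal are at most `N`, within the ball of radius
`N`. -/
def sublevel (g : Euc d × Euc d → ℝ) (N : ℝ) : Set (Euc d × Euc d) :=
  {q | ‖q.1‖ ≤ N ∧ ‖q.2‖ ≤ N ∧ g q ≤ N ∧ sndMarginal g q.2 ≤ N}

theorem measurableSet_sublevel {g : Euc d × Euc d → ℝ} (hg : Measurable g) (N : ℝ) :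
    MeasurableSet (sublevel g N) := by
  have h : Measurable fun q : Euc d × Euc d => sndMarginal g q.2 :=
    (measurable_sndMarginal hg).comp measurable_snd
  exact (measurableSet_le measurable_fst.norm measurable_const).inter
    ((measurableSet_le measurable_snd.norm measurable_const).inter
    ((measurableSet_le hg measurable_const).inter (measurableSet_le h measurable_const)))

theorem sublevel_mono (g : Euc d × Euc d → ℝ) : Monotone (sublevel g) :=
  fun _ _ h _ hq => ⟨hq.1.trans h, hq.2.1.trans h, hq.2.2.1.trans h, hq.2.2.2.trans h⟩

theorem eventually_mem_sublevel (g : Euc d × Euc d → ℝ) (q : Euc d × Euc d) :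
    ∀ᶠ N in atTop, q ∈ sublevel g N := by
  filter_upwards [eventually_ge_atTop ‖q.1‖, eventually_ge_atTop ‖q.2‖,
    eventually_ge_atTop (g q), eventually_ge_atTop (sndMarginal g q.2)] with N h1 h2 h3 h4
  exact ⟨h1, h2, h3, h4⟩

theorem integrable_section_of_bounded {F : Euc d × Euc d → ℝ} (hF : Measurable F) {N B : ℝ}
    (hB : ∀ q, |F q| ≤ B) (hN : ∀ q, F q ≠ 0 → ‖q.2‖ ≤ N) (x : Euc d) :
    Integrable fun y => F (x, y) :=
  integrable_of_bounded_support (N := N) (hF.comp measurable_prodMk_left).aestronglyMeasurable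
    (Eventually.of_forall fun y => hB (x, y)) (Eventually.of_forall fun y => hN (x, y))

theorem fstMarginal_le_of_bounded {F : Euc d × Euc d → ℝ} {N B : ℝ}
    (hB : ∀ q, |F q| ≤ B) (hN : ∀ q, F q ≠ 0 → ‖q.2‖ ≤ N) (x : Euc d) :
    |fstMarginal F x| ≤ B * (volume (Metric.closedBall (0 : Euc d) N)).toReal := by
  have h1 : fstMarginal F x = ∫ y in Metric.closedBall (0 : Euc d) N, F (x, y) := by
    refine (setIntegral_eq_integral_of_forall_compl_eq_zero fun y hy => ?_).symm
    by_contra h0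
    exact hy (by simpa using hN _ h0)
  rw [h1]
  exact norm_setIntegral_le_of_norm_le_const (f := fun y => F (x, y))
    (isCompact_closedBall (0 : Euc d) N).measure_lt_top fun y _ => hB (x, y)

variable {u : ℝ → ℝ} {b g : Euc d × Euc d → ℝ} {K τ : ℝ}

/-- Mass cannot be created at points of zero density: the entropy has slope `-∞` there. -/
theorem IsMinPlan.integral_indicator_le (hg : IsMinPlan b τ u g) (hu : EnergyDensity u)
    (hb : QuadraticCost b K) (hτ : 0 < τ) {N : ℝ} {Ψ : Euc d × Euc d → ℝ}
    (hΨ : Perturbation N g Ψ) (hpos : ∀ q, 0 ≤ g q + Ψ q) :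
    ∫ q, {q | g q = 0}.indicator Ψ q ≤ 0 := by
  set Φ : ℝ → ℝ := fun s => s * Real.log s with hΦ
  have hZ : MeasurableSet {q | g q = 0} := hg.adm.meas (measurableSet_singleton 0)
  have hI2 := hΨ.integrable_entropy_sub hg.adm hpos
  have hI3 := hΨ.integrable_internal_sub hu hg.adm hpos
  have hI0 := hΨ.integrable.indicator hZ
  set m₀ := ∫ q, {q | g q = 0}.indicator Ψ q
  set I := (∫ q, b q * Ψ q) +
      τ * (∫ q, ((g q + Ψ q) * Real.log (g q + Ψ q) - g q * Real.log (g q))) +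
      ∫ y, (u (sndMarginal (fun q => g q + Ψ q) y) - u (sndMarginal g y)) with hI
  have key : ∀ t : ℝ, 0 ≤ t → t * (τ * m₀) ≤ I := by
    intro t ht
    set s := Real.exp (-t) with hs
    have hs0 : 0 < s := Real.exp_pos _
    have hs1 : s ≤ 1 := Real.exp_le_one_iff.2 (by linarith)
    have hlog : Real.log s = -t := Real.log_exp _
    have hpos' : ∀ q, 0 ≤ g q + s * Ψ q := fun q => by
      have h1 := mul_nonneg hs0.le (hpos q)
      have h2 := mul_nonneg (sub_nonneg.2 hs1) (hg.adm.nonneg q)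
      linarith
    have hmain := (hΨ.const_mul s).energy_variation_nonneg hu hb hg hpos'
    have e1 : ∫ q, b q * (s * Ψ q) = s * ∫ q, b q * Ψ q := by
      rw [← integral_const_mul]; congr 1; ext q; ring
    have e2 : ∫ q, ((g q + s * Ψ q) * Real.log (g q + s * Ψ q) - g q * Real.log (g q)) ≤
        s * (∫ q, ((g q + Ψ q) * Real.log (g q + Ψ q) - g q * Real.log (g q))) +
          s * (-t) * m₀ := by
      rw [← integral_const_mul, ← integral_const_mul,
        ← integral_add (hI2.const_mul s) (hI0.const_mul _)]
      refine integral_mono ((hΨ.const_mul s).integrable_entropy_sub hg.adm hpos')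
        ((hI2.const_mul s).add (hI0.const_mul _)) fun q => ?_
      by_cases hq : g q = 0
      · rw [Set.indicator_of_mem (by exact hq)]
        simp only [hq, zero_add, zero_mul, sub_zero]
        by_cases h0 : Ψ q = 0
        · simp [h0]
        rw [Real.log_mul hs0.ne' h0, hlog]
        exact le_of_eq (by ring)
      · rw [Set.indicator_of_notMem (by exact hq), mul_zero, add_zero]
        have := energyDensity_mul_log.convex.2 (Set.mem_Ici.2 (hg.adm.nonneg q))
          (Set.mem_Ici.2 (hpos q)) (sub_nonneg.2 hs1) hs0.le (by ring)
        simp only [smul_eq_mul] at this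
        have e : (1 - s) * g q + s * (g q + Ψ q) = g q + s * Ψ q := by ring
        rw [e] at this
        linarith
    have e3 : ∫ y, (u (sndMarginal (fun q => g q + s * Ψ q) y) - u (sndMarginal g y)) ≤
        s * ∫ y, (u (sndMarginal (fun q => g q + Ψ q) y) - u (sndMarginal g y)) := by
      rw [← integral_const_mul]
      refine integral_mono_ae ((hΨ.const_mul s).integrable_internal_sub hu hg.adm hpos')
        (hI3.const_mul s) ?_
      filter_upwards [hΨ.sndMarginal_add hg.adm.integrable,
        (hΨ.const_mul s).sndMarginal_add hg.adm.integrable] with y h1 h2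
      have e4 : sndMarginal (fun q => s * Ψ q) y = s * sndMarginal Ψ y := integral_const_mul _ _
      have := hu.convex.2 (Set.mem_Ici.2 (sndMarginal_nonneg hg.adm.nonneg y))
          (Set.mem_Ici.2 (sndMarginal_nonneg hpos y)) (sub_nonneg.2 hs1) hs0.le (by ring)
      simp only [smul_eq_mul] at this
      have e : (1 - s) * sndMarginal g y + s * sndMarginal (fun q => g q + Ψ q) y =
          sndMarginal (fun q => g q + s * Ψ q) y := by rw [h1, h2, e4]; ring
      rw [e] at this
      linarith
    rw [e1] at hmain
    have e5 := mul_le_mul_of_nonneg_left e2 hτ.le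
    have : 0 ≤ s * (I - t * (τ * m₀)) := by rw [hI]; linarith
    linarith [nonneg_of_mul_nonneg_right this hs0]
  by_contra hm
  push Not at hm
  have h1 := key ((|I| + 1) / (τ * m₀)) (by positivity)
  rw [div_mul_cancel₀ _ (by positivity)] at h1
  linarith [le_abs_self I]

theorem IsMinPlan.ae_pos (hg : IsMinPlan b τ u g) (hu : EnergyDensity u)
    (hb : QuadraticCost b K) (hτ : 0 < τ) :
    ∀ᵐ q : Euc d × Euc d, 0 < fstMarginal g q.1 → 0 < g q := by
  have hN : ∀ N : ℕ, ∀ᵐ q : Euc d × Euc d, q ∈ sublevel g N → g q = 0 →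
      fstMarginal ((sublevel g N).indicator g) q.1 = 0 := by
    intro N
    have hD := measurableSet_sublevel hg.adm.meas (N : ℝ)
    have hZ : MeasurableSet (sublevel g N ∩ {q | g q = 0}) :=
      hD.inter (hg.adm.meas (measurableSet_singleton 0))
    set F₁ := (sublevel g N).indicator g with hF₁
    set F₀ := (sublevel g N ∩ {q | g q = 0}).indicator (1 : Euc d × Euc d → ℝ) with hF₀
    have hF₁m : Measurable F₁ := hg.adm.meas.indicator hD
    have hF₀m : Measurable F₀ := measurable_one.indicator hZ
    have hF₁0 : ∀ q, 0 ≤ F₁ q := Set.indicator_nonneg fun q _ => hg.adm.nonneg q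
    have hF₀0 : ∀ q, 0 ≤ F₀ q := Set.indicator_nonneg fun q _ => zero_le_one
    have hF₁b : ∀ q, |F₁ q| ≤ N := fun q => by
      rw [abs_of_nonneg (hF₁0 q)]
      by_cases hq : q ∈ sublevel g N
      · rw [hF₁, Set.indicator_of_mem hq]; exact hq.2.2.1
      · rw [hF₁, Set.indicator_of_notMem hq]; positivity
    have hF₀b : ∀ q, |F₀ q| ≤ 1 := fun q => by
      rw [abs_of_nonneg (hF₀0 q)]
      exact Set.indicator_le' (fun _ _ => le_rfl) (fun _ _ => zero_le_one) q
    have hF₁s : ∀ q, F₁ q ≠ 0 → q ∈ sublevel g N := fun q hq => Set.mem_of_indicator_ne_zero hq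
    have hF₀s : ∀ q, F₀ q ≠ 0 → q ∈ sublevel g N := fun q hq =>
      (Set.mem_of_indicator_ne_zero hq).1
    set V := (volume (Metric.closedBall (0 : Euc d) N)).toReal with hV
    have hV0 : 0 ≤ V := ENNReal.toReal_nonneg
    have hA : ∀ x, |fstMarginal F₁ x| ≤ N * V :=
      fstMarginal_le_of_bounded hF₁b fun q hq => (hF₁s q hq).2.1
    have hz : ∀ x, |fstMarginal F₀ x| ≤ 1 * V :=
      fstMarginal_le_of_bounded hF₀b fun q hq => (hF₀s q hq).2.1
    have hA0 := fstMarginal_nonneg hF₁0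
    have hz0 := fstMarginal_nonneg hF₀0
    set Ψ : Euc d × Euc d → ℝ := fun q =>
      (V + 1)⁻¹ * (F₀ q * fstMarginal F₁ q.1 - F₁ q * fstMarginal F₀ q.1) with hΨdef
    have hΨ : Perturbation N g Ψ := by
      refine ⟨?_, ⟨(V + 1)⁻¹ * (1 * (N * V) + N * (1 * V)), by positivity, fun q => ?_⟩,
        fun q hq => ?_, fun x => ?_⟩
      · exact ((hF₀m.mul ((measurable_fstMarginal hF₁m).comp measurable_fst)).sub
          (hF₁m.mul ((measurable_fstMarginal hF₀m).comp measurable_fst))).const_mul _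
      · rw [hΨdef]
        simp only
        rw [abs_mul, abs_of_nonneg (by positivity : (0:ℝ) ≤ (V + 1)⁻¹)]
        refine mul_le_mul_of_nonneg_left ((abs_sub _ _).trans (add_le_add ?_ ?_)) (by positivity)
        · rw [abs_mul]
          exact mul_le_mul (hF₀b q) (hA _) (abs_nonneg _) zero_le_one
        · rw [abs_mul]
          exact mul_le_mul (hF₁b q) (hz _) (abs_nonneg _) (by positivity)
      · by_contra hq'
        have h1 : F₁ q = 0 := by_contra fun h => hq' (hF₁s q h)
        have h0 : F₀ q = 0 := by_contra fun h => hq' (hF₀s q h)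
        exact hq (by simp [hΨdef, h1, h0])
      · have i1 := integrable_section_of_bounded hF₁m hF₁b (fun q hq => (hF₁s q hq).2.1) x
        have i0 := integrable_section_of_bounded hF₀m hF₀b (fun q hq => (hF₀s q hq).2.1) x
        simp only [hΨdef]
        rw [integral_const_mul, integral_sub (i0.mul_const _) (i1.mul_const _),
          integral_mul_const, integral_mul_const]
        change _ * (fstMarginal F₀ x * _ - fstMarginal F₁ x * _) = 0
        ring
    have hpos : ∀ q, 0 ≤ g q + Ψ q := fun q => by
      have h1 : F₁ q ≤ g q := Set.indicator_le_self' (fun _ _ => hg.adm.nonneg _) q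
      have h2 : fstMarginal F₀ q.1 ≤ V + 1 := by
        have := (le_abs_self _).trans (hz q.1); linarith
      have h3 : F₁ q * fstMarginal F₀ q.1 ≤ g q * (V + 1) :=
        mul_le_mul h1 h2 (hz0 _) (hg.adm.nonneg q)
      have h4 : 0 ≤ F₀ q * fstMarginal F₁ q.1 := mul_nonneg (hF₀0 q) (hA0 _)
      have h5 : g q = (V + 1)⁻¹ * (g q * (V + 1)) := by field_simp
      have h6 : 0 ≤ (V + 1)⁻¹ * (g q * (V + 1) +
          (F₀ q * fstMarginal F₁ q.1 - F₁ q * fstMarginal F₀ q.1)) :=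
        mul_nonneg (by positivity) (by linarith)
      rw [mul_add, ← h5] at h6
      exact h6
    have hle := hg.integral_indicator_le hu hb hτ hΨ hpos
    have hΨ0 : ∀ q, 0 ≤ {q | g q = 0}.indicator Ψ q := Set.indicator_nonneg fun q hq => by
      have := hpos q
      rwa [show g q = 0 from hq, zero_add] at this
    have hint := hΨ.integrable.indicator (hg.adm.meas (measurableSet_singleton (0 : ℝ)))
    have hzero := (integral_eq_zero_iff_of_nonneg hΨ0 hint).1
      (le_antisymm hle (integral_nonneg hΨ0))
    filter_upwards [hzero] with q hq hqD hq0
    rw [Set.indicator_of_mem (by exact hq0)] at hq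
    have h1 : F₁ q = 0 := by rw [hF₁, Set.indicator_of_mem hqD, hq0]
    have hqZ : q ∈ sublevel g N ∩ {q | g q = 0} := ⟨hqD, hq0⟩
    have h0 : F₀ q = 1 := by rw [hF₀, Set.indicator_of_mem hqZ]; rfl
    simp only [hΨdef, h1, h0, zero_mul, sub_zero, one_mul, Pi.zero_apply] at hq
    exact (mul_eq_zero.1 hq).resolve_left (by positivity)
  have hsec : ∀ᵐ q : Euc d × Euc d, Integrable fun y => g (q.1, y) :=
    Measure.quasiMeasurePreserving_fst.ae (ae_integrable_right hg.adm.integrable)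
  filter_upwards [ae_all_iff.2 hN, hsec] with q hq hint hm
  refine (hg.adm.nonneg q).lt_of_ne fun h0 => ?_
  have hlim : Tendsto (fun N : ℕ => fstMarginal ((sublevel g N).indicator g) q.1) atTop
      (𝓝 (fstMarginal g q.1)) := by
    refine tendsto_integral_of_dominated_convergence (fun y => g (q.1, y)) (fun N => ?_) hint
      (fun N => Eventually.of_forall fun y => ?_) (Eventually.of_forall fun y => ?_)
    · exact ((hg.adm.meas.indicator (measurableSet_sublevel hg.adm.meas _)).comp
        measurable_prodMk_left).aestronglyMeasurable
    · rw [Real.norm_eq_abs, abs_of_nonneg (Set.indicator_nonneg (fun q _ => hg.adm.nonneg q) _)]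
      exact Set.indicator_le_self' (fun _ _ => hg.adm.nonneg _) _
    · refine tendsto_const_nhds.congr' ?_
      filter_upwards [tendsto_natCast_atTop_atTop.eventually
        (eventually_mem_sublevel g (q.1, y))] with N hN
      rw [Set.indicator_of_mem hN]
  obtain ⟨N, hN1, hN2⟩ := ((hlim.eventually (lt_mem_nhds hm)).and
    (tendsto_natCast_atTop_atTop.eventually (eventually_mem_sublevel g q))).exists
  exact hN1.ne' (hq N hN2 h0.symm)

end Variations


section EulerLagrange

variable {d : ℕ} {u : ℝ → ℝ} {b g : Euc d × Euc d → ℝ} {K τ : ℝ}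

/-- First variation of the energy. -/
def firstVariation (b : Euc d × Euc d → ℝ) (τ : ℝ) (u : ℝ → ℝ) (g : Euc d × Euc d → ℝ)
    (q : Euc d × Euc d) : ℝ :=
  b q + τ * (Real.log (g q) + 1) + deriv u (sndMarginal g q.2)

theorem measurable_firstVariation (hb : QuadraticCost b K) (hg : Measurable g) :
    Measurable (firstVariation b τ u g) :=
  (hb.cont.measurable.add (((Real.measurable_log.comp hg).add_const 1).const_mul τ)).add
    ((measurable_deriv u).comp ((measurable_sndMarginal hg).comp measurable_snd))

/-- The part of `sublevel g N` where `g` and its second marginal are at least `N⁻¹`. -/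
def core (g : Euc d × Euc d → ℝ) (N : ℝ) : Set (Euc d × Euc d) :=
  {q | q ∈ sublevel g N ∧ N⁻¹ ≤ g q ∧ N⁻¹ ≤ sndMarginal g q.2}

theorem measurableSet_core (hg : Measurable g) (N : ℝ) : MeasurableSet (core g N) := by
  have h : Measurable fun q : Euc d × Euc d => sndMarginal g q.2 :=
    (measurable_sndMarginal hg).comp measurable_snd
  exact (measurableSet_sublevel hg N).inter
    ((measurableSet_le measurable_const hg).inter (measurableSet_le measurable_const h))

theorem core_mono {N M : ℝ} (hN : 0 < N) (h : N ≤ M) : core g N ⊆ core g M :=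
  fun _ hq => ⟨sublevel_mono g h hq.1, (inv_anti₀ hN h).trans hq.2.1,
    (inv_anti₀ hN h).trans hq.2.2⟩

theorem eventually_mem_core {q : Euc d × Euc d} (h1 : 0 < g q) (h2 : 0 < sndMarginal g q.2) :
    ∀ᶠ N in atTop, q ∈ core g N := by
  filter_upwards [eventually_mem_sublevel g q,
    tendsto_inv_atTop_zero.eventually (gt_mem_nhds h1),
    tendsto_inv_atTop_zero.eventually (gt_mem_nhds h2)] with N h3 h4 h5
  exact ⟨h3, h4.le, h5.le⟩

theorem exists_bound_on_core (hu : EnergyDensity u) (hb : QuadraticCost b K) {N : ℝ}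
    (hN : 0 < N) : ∃ B, 0 ≤ B ∧ ∀ q ∈ core g N, |firstVariation b τ u g q| ≤ B ∧
      |Real.log (g q) + 1| ≤ B ∧ |deriv u (sndMarginal g q.2)| ≤ B := by
  have hK := hb.pos
  set B₁ := |deriv u N⁻¹| + |deriv u N| with hB₁
  set B₂ := |deriv (fun s => s * Real.log s) N⁻¹| + |deriv (fun s => s * Real.log s) N| with hB₂
  refine ⟨K * (N ^ 2 + N ^ 2 + 1) + |τ| * B₂ + B₁ + B₂, by positivity, fun q hq => ?_⟩
  obtain ⟨⟨h1, h2, h3, h4⟩, h5, h6⟩ := hq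
  have hNi : 0 < N⁻¹ := inv_pos.2 hN
  have e1 : |deriv u (sndMarginal g q.2)| ≤ B₁ := hu.abs_deriv_le hNi h6 h4
  have e2 : |Real.log (g q) + 1| ≤ B₂ := by
    rw [← Real.deriv_mul_log (hNi.trans_le h5).ne']
    exact energyDensity_mul_log.abs_deriv_le hNi h5 h3
  have e3 : |b q| ≤ K * (N ^ 2 + N ^ 2 + 1) := by
    rw [abs_of_nonneg (hb.nonneg q)]
    refine (hb.le q).trans ?_
    gcongr
  have e4 : |τ * (Real.log (g q) + 1)| ≤ |τ| * B₂ := by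
    rw [abs_mul]; gcongr
  have p0 : 0 ≤ |τ| * B₂ := by positivity
  have p1 : 0 ≤ B₁ := by positivity
  have p2 : 0 ≤ B₂ := by positivity
  have p3 : 0 ≤ K * (N ^ 2 + N ^ 2 + 1) := by positivity
  refine ⟨?_, by linarith, by linarith⟩
  have := (abs_add_le (b q + τ * (Real.log (g q) + 1)) (deriv u (sndMarginal g q.2)))
  have := abs_add_le (b q) (τ * (Real.log (g q) + 1))
  simp only [firstVariation]
  linarith

theorem IsMinPlan.integral_firstVariation_nonneg (hg : IsMinPlan b τ u g) (hu : EnergyDensity u)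
    (hb : QuadraticCost b K) (hτ : 0 < τ) {N : ℝ} (hN : 0 < N) {Ψ : Euc d × Euc d → ℝ}
    (hΨ : Perturbation N g Ψ) (hcore : ∀ q, Ψ q ≠ 0 → q ∈ core g N) :
    0 ≤ ∫ q, firstVariation b τ u g q * Ψ q := by
  obtain ⟨B, hB0, hB⟩ := hΨ.bdd
  obtain ⟨B', hB'0, hB'⟩ := hΨ.exists_sndMarginal_le
  obtain ⟨D, hD0, hD⟩ := exists_bound_on_core (g := g) (τ := τ) hu hb hN
  have hgm := hg.adm.meas
  have hbound : ∀ {F : Euc d × Euc d → ℝ}, Measurable F → (∀ q ∈ core g N, |F q| ≤ D) →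
      Integrable fun q => F q * Ψ q := fun {F} hF h => by
    refine hΨ.integrable_of_ne_zero (B := D * B) (hF.mul hΨ.meas) (fun q => ?_)
      fun q hq => by simp [hq]
    by_cases hq : Ψ q = 0
    · simp only [hq, mul_zero, abs_zero]; positivity
    · rw [abs_mul]
      exact mul_le_mul (h q (hcore q hq)) (hB q) (abs_nonneg _) hD0
  have i1 : Integrable fun q => (Real.log (g q) + 1) * Ψ q :=
    hbound (F := fun q => Real.log (g q) + 1) ((Real.measurable_log.comp hgm).add_const 1)
      fun q hq => (hD q hq).2.1
  have i2 := hbound (F := fun q => deriv u (sndMarginal g q.2))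
    ((measurable_deriv u).comp ((measurable_sndMarginal hgm).comp measurable_snd))
    fun q hq => (hD q hq).2.2
  have i0 := hΨ.integrable_mul_continuous hb.cont
  have hsum : ∫ q, firstVariation b τ u g q * Ψ q = (∫ q, b q * Ψ q) +
      τ * (∫ q, (Real.log (g q) + 1) * Ψ q) +
      ∫ q, deriv u (sndMarginal g q.2) * Ψ q := by
    have e : ∀ q, firstVariation b τ u g q * Ψ q = b q * Ψ q +
        τ * ((Real.log (g q) + 1) * Ψ q) + deriv u (sndMarginal g q.2) * Ψ q := fun q => by
      simp only [firstVariation]; ring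
    simp only [e]
    rw [integral_add (f := fun q => b q * Ψ q + τ * ((Real.log (g q) + 1) * Ψ q))
      (i0.add (i1.const_mul τ)) i2, integral_add i0 (i1.const_mul τ), integral_const_mul]
  have hfub : ∫ q, deriv u (sndMarginal g q.2) * Ψ q =
      ∫ y, deriv u (sndMarginal g y) * sndMarginal Ψ y := by
    rw [← integral_sndMarginal i2]
    exact integral_congr_ae (Eventually.of_forall fun y =>
      integral_const_mul (deriv u (sndMarginal g y)) fun x => Ψ (x, y))
  have hlog : ∫ q, (Real.log (g q) + 1) * Ψ q =
      ∫ q, deriv (fun s => s * Real.log s) (g q) * Ψ q := by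
    refine integral_congr_ae (Eventually.of_forall fun q => ?_)
    by_cases hq : Ψ q = 0
    · simp [hq]
    · simp only
      rw [Real.deriv_mul_log ((inv_pos.2 hN).trans_le (hcore q hq).2.1).ne']
  rw [hsum, hfub, hlog]
  refine le_of_forall_pos_le_add fun e he => ?_
  have he' : 0 < e / (τ + 1) := by positivity
  have hs1 := energyDensity_mul_log.eventually_integral_sub_le
    (μ := (volume : Measure (Euc d × Euc d))) hgm hΨ.meas
    hg.adm.nonneg hN hB (fun q hq => ⟨max_le (hΨ.supp q hq).1 (hΨ.supp q hq).2.1,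
      (hcore q hq).2.1, (hΨ.supp q hq).2.2.1⟩) he'
  have hs2 := hu.eventually_integral_sub_le (μ := (volume : Measure (Euc d)))
    (measurable_sndMarginal hgm)
    (measurable_sndMarginal hΨ.meas) (sndMarginal_nonneg hg.adm.nonneg) hN hB' (fun y hy => by
      obtain ⟨x, hx⟩ : ∃ x, Ψ (x, y) ≠ 0 := by
        by_contra! h
        exact hy (by simp [sndMarginal, h])
      exact ⟨(hΨ.supp _ hx).2.1, (hcore _ hx).2.2, (hΨ.supp _ hx).2.2.2⟩) he'
  have hs3 : ∀ᶠ s in 𝓝[>] (0 : ℝ), s ∈ Set.Ioc 0 (N * (B + 1))⁻¹ :=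
    Ioc_mem_nhdsGT (by positivity)
  obtain ⟨s, h1, h2, hs, hs'⟩ := (hs1.and (hs2.and hs3)).exists
  have hpos : ∀ q, 0 ≤ g q + s * Ψ q := fun q => by
    by_cases hq : Ψ q = 0
    · simpa [hq] using hg.adm.nonneg q
    have h3 : |s * Ψ q| ≤ N⁻¹ := by
      rw [abs_mul, abs_of_pos hs]
      calc s * |Ψ q| ≤ (N * (B + 1))⁻¹ * (B + 1) := by
            gcongr
            linarith [hB q]
        _ = N⁻¹ := by field_simp
    have := (abs_le.1 h3).1
    have := (hcore q hq).2.1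
    linarith
  have hmain := (hΨ.const_mul s).energy_variation_nonneg hu hb hg hpos
  have e1 : ∫ q, b q * (s * Ψ q) = s * ∫ q, b q * Ψ q := by
    rw [← integral_const_mul]; congr 1; ext q; ring
  have e3 : ∫ y, (u (sndMarginal (fun q => g q + s * Ψ q) y) - u (sndMarginal g y)) =
      ∫ y, (u (sndMarginal g y + s * sndMarginal Ψ y) - u (sndMarginal g y)) := by
    refine integral_congr_ae ?_
    filter_upwards [(hΨ.const_mul s).sndMarginal_add hg.adm.integrable] with y hy
    have e4 : sndMarginal (fun q => s * Ψ q) y = s * sndMarginal Ψ y := integral_const_mul _ _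
    rw [hy, e4]
  rw [e1, e3] at hmain
  have h5 := mul_le_mul_of_nonneg_left h1 hτ.le
  have h6 : e = τ * (e / (τ + 1)) + e / (τ + 1) := by field_simp
  have h7 : 0 ≤ s * ((∫ q, b q * Ψ q) +
      τ * (∫ q, deriv (fun s => s * Real.log s) (g q) * Ψ q) +
      (∫ y, deriv u (sndMarginal g y) * sndMarginal Ψ y) + (τ * (e / (τ + 1)) + e / (τ + 1))) := by
    linarith
  rw [← h6] at h7
  exact nonneg_of_mul_nonneg_right h7 hs

theorem IsMinPlan.firstVariation_eq_on_core (hg : IsMinPlan b τ u g) (hu : EnergyDensity u)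
    (hb : QuadraticCost b K) (hτ : 0 < τ) {N : ℝ} (hN : 0 < N) :
    ∃ a : Euc d → ℝ, ∀ᵐ q : Euc d × Euc d, q ∈ core g N → firstVariation b τ u g q = a q.1 := by
  obtain ⟨D, hD0, hD⟩ := exists_bound_on_core (g := g) (τ := τ) hu hb hN
  have hS := measurableSet_core hg.adm.meas N
  set G := firstVariation b τ u g with hG
  have hGm : Measurable G := measurable_firstVariation hb hg.adm.meas
  set F₁ := (core g N).indicator G with hF₁
  set F₀ := (core g N).indicator (1 : Euc d × Euc d → ℝ) with hF₀
  have hF₁m : Measurable F₁ := hGm.indicator hS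
  have hF₀m : Measurable F₀ := measurable_one.indicator hS
  have hF₀0 : ∀ q, 0 ≤ F₀ q := Set.indicator_nonneg fun q _ => zero_le_one
  have hF₀1 : ∀ q, F₀ q ≤ 1 := Set.indicator_le' (fun _ _ => le_rfl) (fun _ _ => zero_le_one)
  have hF₁₀ : ∀ q, |F₁ q| ≤ D * F₀ q := fun q => by
    by_cases hq : q ∈ core g N
    · rw [hF₁, hF₀, Set.indicator_of_mem hq, Set.indicator_of_mem hq]
      simpa using (hD q hq).1
    · rw [hF₁, hF₀, Set.indicator_of_notMem hq, Set.indicator_of_notMem hq]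
      simp
  have hF₁b : ∀ q, |F₁ q| ≤ D := fun q =>
    (hF₁₀ q).trans (mul_le_of_le_one_right hD0 (hF₀1 q))
  have hF₀b : ∀ q, |F₀ q| ≤ 1 := fun q => by rw [abs_of_nonneg (hF₀0 q)]; exact hF₀1 q
  have hF₁s : ∀ q, F₁ q ≠ 0 → q ∈ core g N := fun q hq => Set.mem_of_indicator_ne_zero hq
  have hF₀s : ∀ q, F₀ q ≠ 0 → q ∈ core g N := fun q hq => Set.mem_of_indicator_ne_zero hq
  have i1 := integrable_section_of_bounded hF₁m hF₁b fun q hq => (hF₁s q hq).1.2.1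
  have i0 := integrable_section_of_bounded hF₀m hF₀b fun q hq => (hF₀s q hq).1.2.1
  have hle : ∀ x, |fstMarginal F₁ x| ≤ D * fstMarginal F₀ x := fun x => by
    have h1 : |fstMarginal F₁ x| ≤ ∫ y, |F₁ (x, y)| :=
      norm_integral_le_integral_norm fun y => F₁ (x, y)
    have h2 : ∫ y, |F₁ (x, y)| ≤ ∫ y, D * F₀ (x, y) :=
      integral_mono (i1 x).norm ((i0 x).const_mul D) fun y => hF₁₀ (x, y)
    rw [integral_const_mul] at h2
    exact h1.trans h2
  have hA0 := fstMarginal_nonneg hF₀0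
  set a : Euc d → ℝ := fun x => fstMarginal F₁ x / fstMarginal F₀ x with ha
  have hab : ∀ x, |a x| ≤ D := fun x => by
    rw [ha]
    simp only
    rw [abs_div, abs_of_nonneg (hA0 x)]
    exact div_le_of_le_mul₀ (hA0 x) hD0 (hle x)
  have ham : Measurable a := (measurable_fstMarginal hF₁m).div (measurable_fstMarginal hF₀m)
  have ha' : ∀ x, a x * fstMarginal F₀ x = fstMarginal F₁ x := fun x => by
    by_cases h : fstMarginal F₀ x = 0
    · have := hle x
      rw [h, mul_zero] at this
      rw [h, mul_zero, abs_nonpos_iff.1 this]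
    · exact div_mul_cancel₀ _ h
  set Ψ : Euc d × Euc d → ℝ := fun q => a q.1 * F₀ q - F₁ q with hΨdef
  have hΨcore : ∀ q, Ψ q ≠ 0 → q ∈ core g N := fun q hq => by
    by_contra hq'
    have h1 : F₁ q = 0 := by_contra fun h => hq' (hF₁s q h)
    have h0 : F₀ q = 0 := by_contra fun h => hq' (hF₀s q h)
    exact hq (by simp [hΨdef, h1, h0])
  have hΨ : Perturbation N g Ψ := by
    refine ⟨((ham.comp measurable_fst).mul hF₀m).sub hF₁m, ⟨D * 1 + D, by positivity, fun q => ?_⟩,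
      fun q hq => (hΨcore q hq).1, fun x => ?_⟩
    · refine (abs_sub _ _).trans (add_le_add ?_ (hF₁b q))
      rw [abs_mul]
      exact mul_le_mul (hab _) (hF₀b q) (abs_nonneg _) hD0
    · simp only [hΨdef]
      rw [integral_sub ((i0 x).const_mul _) (i1 x), integral_const_mul]
      exact sub_eq_zero.2 (ha' x)
  have hnn := hg.integral_firstVariation_nonneg hu hb hτ hN hΨ hΨcore
  have hΨb : ∀ q, |Ψ q| ≤ D + D := fun q => by
    refine (abs_sub _ _).trans (add_le_add ?_ (hF₁b q))
    rw [abs_mul]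
    calc |a q.1| * |F₀ q| ≤ D * 1 := mul_le_mul (hab _) (hF₀b q) (abs_nonneg _) hD0
      _ = D := mul_one D
  have j1 : Integrable fun q => a q.1 * Ψ q := by
    refine hΨ.integrable_of_ne_zero (B := D * (D + D)) ((ham.comp measurable_fst).mul hΨ.meas)
      (fun q => ?_) fun q hq => by simp [hq]
    rw [abs_mul]
    exact mul_le_mul (hab _) (hΨb q) (abs_nonneg _) hD0
  have j2 : Integrable fun q => Ψ q * Ψ q := by
    refine hΨ.integrable_of_ne_zero (B := (D + D) * (D + D)) (hΨ.meas.mul hΨ.meas)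
      (fun q => ?_) fun q hq => by simp [hq]
    rw [abs_mul]
    exact mul_le_mul (hΨb q) (hΨb q) (abs_nonneg _) (by positivity)
  have e1 : ∀ q, G q * Ψ q = a q.1 * Ψ q - Ψ q * Ψ q := fun q => by
    by_cases hq : q ∈ core g N
    · have h1 : F₁ q = G q := Set.indicator_of_mem hq _
      have h0 : F₀ q = 1 := Set.indicator_of_mem hq _
      simp only [hΨdef, h1, h0]; ring
    · have : Ψ q = 0 := by_contra fun h => hq (hΨcore q h)
      simp [this]
  have e2 : ∫ q, a q.1 * Ψ q = 0 := by
    rw [← integral_fstMarginal j1]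
    have : ∀ x, fstMarginal (fun q => a q.1 * Ψ q) x = 0 := fun x => by
      simp only [fstMarginal]
      rw [integral_const_mul, hΨ.marginal, mul_zero]
    simp [this]
  have e3 : ∫ q, G q * Ψ q = ∫ q, (a q.1 * Ψ q - Ψ q * Ψ q) :=
    integral_congr_ae (Eventually.of_forall e1)
  rw [← hG, e3, integral_sub j1 j2, e2] at hnn
  have hsq : ∀ q, 0 ≤ Ψ q * Ψ q := fun q => mul_self_nonneg _
  have hzero := (integral_eq_zero_iff_of_nonneg hsq j2).1
    (le_antisymm (by linarith) (integral_nonneg hsq))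
  refine ⟨a, ?_⟩
  filter_upwards [hzero] with q hq hqc
  have h1 : F₁ q = G q := Set.indicator_of_mem hqc _
  have h0 : F₀ q = 1 := Set.indicator_of_mem hqc _
  have := mul_self_eq_zero.1 hq
  simp only [hΨdef, h1, h0] at this
  linarith

theorem ae_eq_const_of_iUnion {α : Type*} [MeasurableSpace α] {μ : Measure α} {G : α → ℝ}
    {S : ℕ → Set α} (hS : Monotone S) (hun : ∀ᵐ y ∂μ, ∃ k, y ∈ S k)
    (h : ∀ k, ∃ a : ℝ, ∀ᵐ y ∂μ, y ∈ S k → G y = a) : ∃ a : ℝ, ∀ᵐ y ∂μ, G y = a := by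
  choose a ha using h
  by_cases hk : ∃ k, μ (S k) ≠ 0
  · obtain ⟨k, hk⟩ := hk
    refine ⟨a k, ?_⟩
    have hconst : ∀ l, k ≤ l → a l = a k := by
      intro l hl
      by_contra hne
      refine hk (measure_mono_null (t := {y | ¬ ((y ∈ S k → G y = a k) ∧ (y ∈ S l → G y = a l))})
        (fun y hy hy' => hne ?_) (ae_iff.1 ((ha k).and (ha l))))
      rw [← hy'.1 hy, ← hy'.2 (hS hl hy)]
    filter_upwards [hun, ae_all_iff.2 ha] with y ⟨l, hl⟩ hy
    rw [hy (max k l) (hS (le_max_right k l) hl), hconst _ (le_max_left k l)]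
  · push Not at hk
    refine ⟨0, ?_⟩
    have : ∀ k, ∀ᵐ y ∂μ, y ∉ S k := fun k => measure_eq_zero_iff_ae_notMem.1 (hk k)
    filter_upwards [hun, ae_all_iff.2 this] with y ⟨l, hl⟩ hy
    exact absurd hl (hy l)

/-- The Gibbs weight `exp (-(b + u' ∘ n) / τ)` and its partition function. -/
def gibbsWeight (τ : ℝ) (u : ℝ → ℝ) (g : Euc d × Euc d → ℝ) (y : Euc d) : ℝ :=
  Real.exp (-(deriv u (sndMarginal g y)) / τ)

def gibbsKernel (b : Euc d × Euc d → ℝ) (τ : ℝ) (q : Euc d × Euc d) : ℝ := Real.exp (-(b q) / τ)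

def partition (b : Euc d × Euc d → ℝ) (τ : ℝ) (u : ℝ → ℝ) (g : Euc d × Euc d → ℝ)
    (x : Euc d) : ℝ :=
  ∫ y, gibbsKernel b τ (x, y) * gibbsWeight τ u g y

theorem measurable_gibbsWeight (hg : Measurable g) : Measurable (gibbsWeight τ u g) :=
  Real.measurable_exp.comp
    (((measurable_deriv u).comp (measurable_sndMarginal hg)).neg.div_const τ)

theorem QuadraticCost.continuous_gibbsKernel (hb : QuadraticCost b K) :
    Continuous (gibbsKernel b τ) := Real.continuous_exp.comp (hb.cont.neg.div_const τ)

theorem measurable_partition (hb : QuadraticCost b K) (hg : Measurable g) :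
    Measurable (partition b τ u g) := by
  have h : Measurable fun q : Euc d × Euc d => gibbsKernel b τ q * gibbsWeight τ u g q.2 :=
    hb.continuous_gibbsKernel.measurable.mul ((measurable_gibbsWeight hg).comp measurable_snd)
  exact measurable_fstMarginal h

/-- Minimising plans are Gibbs measures. -/
theorem IsMinPlan.ae_section_eq (hg : IsMinPlan b τ u g) (hu : EnergyDensity u)
    (hb : QuadraticCost b K) (hτ : 0 < τ) :
    ∀ᵐ x : Euc d, 0 < fstMarginal g x → (∀ᵐ y, 0 < sndMarginal g y) ∧
      Integrable (fun y => gibbsKernel b τ (x, y) * gibbsWeight τ u g y) ∧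
      0 < partition b τ u g x ∧
      ∀ᵐ y, g (x, y) = fstMarginal g x / partition b τ u g x *
        (gibbsKernel b τ (x, y) * gibbsWeight τ u g y) := by
  have hcore : ∀ k : ℕ, ∃ a : Euc d → ℝ, ∀ᵐ q : Euc d × Euc d, q ∈ core g ((k : ℝ) + 1) →
      firstVariation b τ u g q = a q.1 := fun k =>
    hg.firstVariation_eq_on_core hu hb hτ (by positivity)
  choose a ha using hcore
  have hsndpos : ∀ᵐ q : Euc d × Euc d, 0 < g q → 0 < sndMarginal g q.2 := by
    have h1 : ∀ᵐ y : Euc d, ∀ᵐ x : Euc d, 0 < g (x, y) → 0 < sndMarginal g y := by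
      filter_upwards [ae_integrable_left hg.adm.integrable] with y hy
      rcases (sndMarginal_nonneg hg.adm.nonneg y).eq_or_lt with h0 | h0
      · have := (integral_eq_zero_iff_of_nonneg (fun x => hg.adm.nonneg (x, y)) hy).1 h0.symm
        filter_upwards [this] with x hx h
        exact absurd hx h.ne'
      · exact Eventually.of_forall fun _ _ => h0
    have hm : Measurable fun q : Euc d × Euc d => sndMarginal g q.2 :=
      (measurable_sndMarginal hg.adm.meas).comp measurable_snd
    have hms : MeasurableSet {q : Euc d × Euc d | 0 < g q → 0 < sndMarginal g q.2} :=
      (measurableSet_lt measurable_const hg.adm.meas).himp (measurableSet_lt measurable_const hm)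
    refine (Measure.ae_prod_iff_ae_ae hms).2 ?_
    exact (Measure.ae_ae_comm (μ := volume) (ν := volume)
      (p := fun x y => 0 < g (x, y) → 0 < sndMarginal g y) hms).2 h1
  have hall := Measure.ae_ae_of_ae_prod (((ae_all_iff.2 ha).and
    (hsndpos.and (hg.ae_pos hu hb hτ))))
  filter_upwards [hall, ae_integrable_right hg.adm.integrable] with x hx hint hm
  have hgpos : ∀ᵐ y, 0 < g (x, y) := by
    filter_upwards [hx] with y hy using hy.2.2 hm
  have hnpos : ∀ᵐ y, 0 < sndMarginal g y := by
    filter_upwards [hx, hgpos] with y hy h using hy.2.1 h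
  obtain ⟨A, hA⟩ : ∃ A, ∀ᵐ y, firstVariation b τ u g (x, y) = A := by
    refine ae_eq_const_of_iUnion (S := fun k : ℕ => {y | (x, y) ∈ core g ((k : ℝ) + 1)})
      (fun k l hkl y hy => core_mono (by positivity) (by gcongr) hy) ?_
      fun k => ⟨a k x, ?_⟩
    · filter_upwards [hgpos, hnpos] with y h1 h2
      exact ((tendsto_atTop_add_const_right _ 1 tendsto_natCast_atTop_atTop).eventually
        (eventually_mem_core (q := (x, y)) h1 h2)).exists
    · filter_upwards [hx] with y hy using hy.1 k
  set c := Real.exp (A / τ - 1) with hc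
  have hcpos : 0 < c := Real.exp_pos _
  have heq : ∀ᵐ y, g (x, y) = c * (gibbsKernel b τ (x, y) * gibbsWeight τ u g y) := by
    filter_upwards [hA, hgpos] with y h1 h2
    rw [← Real.exp_log h2, hc, gibbsKernel, gibbsWeight, ← Real.exp_add, ← Real.exp_add, ← h1]
    congr 1
    simp only [firstVariation]
    field_simp
    ring
  have hint' : Integrable fun y => gibbsKernel b τ (x, y) * gibbsWeight τ u g y := by
    refine (hint.const_mul c⁻¹).congr ?_
    filter_upwards [heq] with y hy
    rw [hy]; field_simp
  have hZ : fstMarginal g x = c * partition b τ u g x := by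
    rw [partition, ← integral_const_mul]
    exact integral_congr_ae heq
  have hZpos : 0 < partition b τ u g x := by
    rw [hZ] at hm; exact pos_of_mul_pos_right hm hcpos.le
  refine ⟨hnpos, hint', hZpos, ?_⟩
  filter_upwards [heq] with y hy
  rw [hy, hZ, mul_div_cancel_right₀ _ hZpos.ne']

end EulerLagrange


section Gibbs

variable {d : ℕ} {u : ℝ → ℝ} {b g : Euc d × Euc d → ℝ} {A : Euc d → ℝ} {K τ : ℝ}

/-- `g` is a Gibbs density with prefactor `A` depending on the first variable. -/
structure IsGibbs (b : Euc d × Euc d → ℝ) (K τ : ℝ) (u : ℝ → ℝ) (g : Euc d × Euc d → ℝ)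
    (A : Euc d → ℝ) : Prop where
  meas : Measurable A
  nonneg : ∀ x, 0 ≤ A x
  eq : ∀ᵐ q : Euc d × Euc d, g q = A q.1 * (gibbsKernel b τ q * gibbsWeight τ u g q.2)
  pos : ∀ᵐ y, 0 < sndMarginal g y
  le : ∃ c, 0 < c ∧ ∀ᵐ x, A x ≤ fstMarginal g x * (c * Real.exp (K * (‖x‖ ^ 2 + 2) / τ))

theorem gibbsKernel_pos (b : Euc d × Euc d → ℝ) (τ : ℝ) (q : Euc d × Euc d) :
    0 < gibbsKernel b τ q := Real.exp_pos _

theorem gibbsWeight_pos (τ : ℝ) (u : ℝ → ℝ) (g : Euc d × Euc d → ℝ) (y : Euc d) :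
    0 < gibbsWeight τ u g y := Real.exp_pos _

theorem partition_nonneg (b : Euc d × Euc d → ℝ) (τ : ℝ) (u : ℝ → ℝ) (g : Euc d × Euc d → ℝ)
    (x : Euc d) : 0 ≤ partition b τ u g x :=
  integral_nonneg fun _ => (mul_pos (gibbsKernel_pos _ _ _) (gibbsWeight_pos _ _ _ _)).le

theorem QuadraticCost.exists_le_partition (hb : QuadraticCost b K) (hτ : 0 < τ)
    (hg : Measurable g) : ∃ c, 0 < c ∧ ∀ x,
      Integrable (fun y => gibbsKernel b τ (x, y) * gibbsWeight τ u g y) →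
      c * Real.exp (-(K * (‖x‖ ^ 2 + 2)) / τ) ≤ partition b τ u g x := by
  set B := Metric.closedBall (0 : Euc d) 1 with hB
  have hBm : MeasurableSet B := Metric.isClosed_closedBall.measurableSet
  set w : Euc d → ℝ := fun y => min (gibbsWeight τ u g y) 1 with hw
  have hwm : Measurable w := (measurable_gibbsWeight hg).min measurable_const
  have hw0 : ∀ y, 0 < w y := fun y => lt_min (gibbsWeight_pos _ _ _ _) one_pos
  have hwi : IntegrableOn w B := by
    refine Measure.integrableOn_of_bounded (M := 1)
      (isCompact_closedBall (0 : Euc d) 1).measure_lt_top.ne hwm.aestronglyMeasurable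
      (Eventually.of_forall fun y => ?_)
    rw [Real.norm_eq_abs, abs_of_pos (hw0 y)]
    exact min_le_right _ _
  refine ⟨∫ y in B, w y, ?_, fun x hx => ?_⟩
  · rw [setIntegral_pos_iff_support_of_nonneg_ae (Eventually.of_forall fun y => (hw0 y).le) hwi]
    have : Function.support w = Set.univ := Function.support_eq_univ fun y => (hw0 y).ne'
    rw [this, Set.univ_inter]
    exact Metric.measure_closedBall_pos _ _ one_pos
  · rw [mul_comm, ← integral_const_mul, partition]
    refine (setIntegral_mono_on (hwi.const_mul _) hx.integrableOn hBm fun y hy => ?_).trans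
      (setIntegral_le_integral hx (Eventually.of_forall fun y =>
        (mul_pos (gibbsKernel_pos _ _ _) (gibbsWeight_pos _ _ _ _)).le))
    have hy1 : ‖y‖ ≤ 1 := by simpa [hB] using hy
    refine mul_le_mul ?_ (min_le_left _ _) (hw0 y).le (gibbsKernel_pos _ _ _).le
    refine Real.exp_le_exp.2 (div_le_div_of_nonneg_right (neg_le_neg ?_) hτ.le)
    refine (hb.le (x, y)).trans (mul_le_mul_of_nonneg_left ?_ hb.pos.le)
    have : ‖y‖ ^ 2 ≤ 1 := pow_le_one₀ (norm_nonneg _) hy1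
    simp only; linarith

theorem IsMinPlan.exists_isGibbs (hg : IsMinPlan b τ u g) (hu : EnergyDensity u)
    (hb : QuadraticCost b K) (hτ : 0 < τ) (hpos : 0 < ∫ q, g q) :
    ∃ A, IsGibbs b K τ u g A := by
  have hsec := hg.ae_section_eq hu hb hτ
  have hm0 := fstMarginal_nonneg hg.adm.nonneg
  have hAm : Measurable fun x => fstMarginal g x / partition b τ u g x :=
    (measurable_fstMarginal hg.adm.meas).div (measurable_partition hb hg.adm.meas)
  obtain ⟨c, hc, hcle⟩ := hb.exists_le_partition (u := u) hτ hg.adm.meas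
  refine ⟨fun x => fstMarginal g x / partition b τ u g x, hAm,
    fun x => div_nonneg (hm0 x) (partition_nonneg _ _ _ _ _), ?_, ?_, c⁻¹, inv_pos.2 hc, ?_⟩
  · refine (Measure.ae_prod_iff_ae_ae (measurableSet_eq_fun hg.adm.meas
      ((hAm.comp measurable_fst).mul (hb.continuous_gibbsKernel.measurable.mul
        ((measurable_gibbsWeight hg.adm.meas).comp measurable_snd))))).2 ?_
    filter_upwards [hsec, ae_integrable_right hg.adm.integrable] with x hx hi
    rcases (hm0 x).eq_or_lt with h0 | h0
    · filter_upwards [(integral_eq_zero_iff_of_nonneg (fun y => hg.adm.nonneg (x, y)) hi).1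
        h0.symm] with y hy
      change g (x, y) = fstMarginal g x / partition b τ u g x * _
      rw [← h0, zero_div, zero_mul]
      exact hy
    · exact (hx h0).2.2.2
  · have : ∃ x, 0 < fstMarginal g x ∧ ∀ᵐ y, 0 < sndMarginal g y := by
      by_contra hcon
      rw [← integral_fstMarginal hg.adm.integrable] at hpos
      refine hpos.ne' (integral_eq_zero_of_ae ?_)
      filter_upwards [hsec] with x hx
      by_contra hne
      have h0 := lt_of_le_of_ne (hm0 x) (Ne.symm hne)
      exact hcon ⟨x, h0, (hx h0).1⟩
    exact this.choose_spec.2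
  · filter_upwards [hsec] with x hx
    rcases (hm0 x).eq_or_lt with h0 | h0
    · simp [← h0]
    · have h1 := hcle x (hx h0).2.1
      have h2 : 0 < c * Real.exp (-(K * (‖x‖ ^ 2 + 2)) / τ) := by positivity
      rw [div_eq_mul_inv]
      refine mul_le_mul_of_nonneg_left ((inv_anti₀ h2 h1).trans_eq ?_) h0.le
      rw [mul_inv, ← Real.exp_neg, neg_div, neg_neg]

theorem Admissible.integrable_mul_fst {g : Euc d × Euc d → ℝ} (hg : Admissible u g)
    {φ : Euc d → ℝ} (hφ : Measurable φ) (h : Integrable fun x => fstMarginal g x * φ x) :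
    Integrable fun q : Euc d × Euc d => g q * φ q.1 := by
  refine (integrable_prod_iff (μ := volume) (ν := volume)
    (f := fun q : Euc d × Euc d => g q * φ q.1) (hg.meas.mul (hφ.comp measurable_fst)).aestronglyMeasurable).2 ⟨?_, ?_⟩
  · filter_upwards [ae_integrable_right hg.integrable] with x hx using hx.mul_const _
  · refine h.norm.congr (Eventually.of_forall fun x => ?_)
    have : ∀ y, ‖g (x, y) * φ x‖ = g (x, y) * |φ x| := fun y => by
      rw [Real.norm_eq_abs, abs_mul, abs_of_nonneg (hg.nonneg _)]
    simp only [this]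
    rw [integral_mul_const, Real.norm_eq_abs, abs_mul,
      abs_of_nonneg (fstMarginal_nonneg hg.nonneg x), fstMarginal]

theorem measurable_press (hu : EnergyDensity u) {φ : Euc d → ℝ} (hφ : Measurable φ)
    (h0 : ∀ y, 0 ≤ φ y) : Measurable fun y => press u (φ y) :=
  (((measurable_deriv u).comp hφ).mul hφ).sub (hu.measurable_comp hφ h0)

/-- The pressure of the second marginal of a Gibbs density is integrable. -/
theorem IsGibbs.integrable_press (h : IsGibbs b K τ u g A) (hu : EnergyDensity u)
    (hb : QuadraticCost b K) (hτ : 0 < τ) (hg : Admissible u g)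
    (hent : Integrable fun x => fstMarginal g x * Real.log (fstMarginal g x)) :
    Integrable fun y => press u (sndMarginal g y) := by
  obtain ⟨c, hc, hle⟩ := h.le
  have hle' : ∀ᵐ q : Euc d × Euc d,
      A q.1 ≤ fstMarginal g q.1 * (c * Real.exp (K * (‖q.1‖ ^ 2 + 2) / τ)) :=
    (Measure.quasiMeasurePreserving_fst (μ := volume) (ν := volume)).ae hle
  set R : Euc d × Euc d → ℝ := fun q => τ * (g q * Real.log (fstMarginal g q.1)) +
    (τ * Real.log c + 2 * K) * g q + K * ((‖q.1‖ ^ 2 + ‖q.2‖ ^ 2) * g q) -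
    τ * (g q * Real.log (g q)) with hR
  have hRi : Integrable R :=
    ((((hg.integrable_mul_fst (Real.measurable_log.comp (measurable_fstMarginal hg.meas))
      hent).const_mul τ).add (hg.integrable.const_mul _)).add (hg.moment.const_mul K)).sub
      (hg.entropy.const_mul τ)
  have hbound : ∀ᵐ q : Euc d × Euc d, deriv u (sndMarginal g q.2) * g q ≤ R q := by
    filter_upwards [h.eq, hle'] with q hq hqA
    rcases (hg.nonneg q).eq_or_lt with h0 | h0
    · simp [hR, ← h0]
    have hA : 0 < A q.1 := by
      by_contra hA
      rw [le_antisymm (not_lt.1 hA) (h.nonneg _), zero_mul] at hq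
      exact h0.ne' hq
    have hm : 0 < fstMarginal g q.1 := by
      by_contra hm
      rw [le_antisymm (not_lt.1 hm) (fstMarginal_nonneg hg.nonneg _), zero_mul] at hqA
      exact hA.not_ge hqA
    have h1 : Real.log (A q.1) ≤ Real.log (fstMarginal g q.1) + (Real.log c +
        K * (‖q.1‖ ^ 2 + 2) / τ) := by
      refine (Real.log_le_log hA hqA).trans_eq ?_
      rw [Real.log_mul hm.ne' (by positivity), Real.log_mul hc.ne' (Real.exp_pos _).ne',
        Real.log_exp]
    have h2 : Real.log (g q) = Real.log (A q.1) + (-(b q) / τ +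
        -(deriv u (sndMarginal g q.2)) / τ) := by
      conv_lhs => rw [hq]
      rw [Real.log_mul hA.ne' (mul_pos (gibbsKernel_pos _ _ _) (gibbsWeight_pos _ _ _ _)).ne',
        Real.log_mul (gibbsKernel_pos _ _ _).ne' (gibbsWeight_pos _ _ _ _).ne', gibbsKernel,
        gibbsWeight, Real.log_exp, Real.log_exp]
    have h3 : deriv u (sndMarginal g q.2) = τ * Real.log (A q.1) - b q - τ * Real.log (g q) := by
      rw [h2]; field_simp; ring
    have h4 : τ * Real.log (A q.1) ≤ τ * Real.log (fstMarginal g q.1) + τ * Real.log c +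
        K * (‖q.1‖ ^ 2 + 2) := by
      refine (mul_le_mul_of_nonneg_left h1 hτ.le).trans_eq ?_
      field_simp
      ring
    have h5 : deriv u (sndMarginal g q.2) ≤ τ * Real.log (fstMarginal g q.1) + τ * Real.log c +
        K * (‖q.1‖ ^ 2 + ‖q.2‖ ^ 2 + 2) - τ * Real.log (g q) := by
      have := hb.nonneg q
      have := mul_nonneg hb.pos.le (sq_nonneg ‖q.2‖)
      rw [h3]; nlinarith
    refine (mul_le_mul_of_nonneg_right h5 h0.le).trans_eq ?_
    simp only [hR]; ring
  have hbound' : ∀ᵐ y : Euc d, ∀ᵐ x : Euc d, deriv u (sndMarginal g y) * g (x, y) ≤ R (x, y) :=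
    Measure.ae_ae_of_ae_prod (p := fun q : Euc d × Euc d =>
      deriv u (sndMarginal g q.1) * g q.swap ≤ R q.swap)
      ((Measure.measurePreserving_swap (μ := volume) (ν := volume)).quasiMeasurePreserving.ae
        hbound)
  refine ((integrable_sndMarginal hRi).sub hg.internal).mono'
    (measurable_press hu (measurable_sndMarginal hg.meas)
      (sndMarginal_nonneg hg.nonneg)).aestronglyMeasurable ?_
  filter_upwards [hbound', ae_integrable_left hg.integrable, ae_integrable_left hRi, h.pos]
    with y hy hi hRy hpos
  rw [Real.norm_eq_abs, abs_of_nonneg (hu.press_nonneg hpos.le)]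
  have h1 := integral_mono_ae (hi.const_mul _) hRy hy
  rw [integral_const_mul] at h1
  exact sub_le_sub_right h1 _

end Gibbs


section BallMass

variable {d : ℕ} {u : ℝ → ℝ} {b g : Euc d × Euc d → ℝ} {A : Euc d → ℝ} {K τ : ℝ}

theorem QuadraticCost.gibbsKernel_le_one (hb : QuadraticCost b K) (hτ : 0 < τ)
    (q : Euc d × Euc d) : gibbsKernel b τ q ≤ 1 :=
  Real.exp_le_one_iff.2 (div_nonpos_of_nonpos_of_nonneg (neg_nonpos.2 (hb.nonneg q)) hτ.le)

theorem IsGibbs.integrableOn_closedBall (h : IsGibbs b K τ u g A) (hb : QuadraticCost b K)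
    (hτ : 0 < τ) (hg : Integrable g) (r : ℝ) :
    IntegrableOn A (Metric.closedBall 0 r) := by
  obtain ⟨c, hc, hle⟩ := h.le
  refine ((integrable_fstMarginal hg).integrableOn.mul_const
    (c * Real.exp (K * (r ^ 2 + 2) / τ))).mono' h.meas.aestronglyMeasurable ?_
  filter_upwards [ae_restrict_of_ae hle,
    ae_restrict_mem Metric.isClosed_closedBall.measurableSet] with x hx hxr
  have hxr' : ‖x‖ ≤ r := by simpa using hxr
  rw [Real.norm_eq_abs, abs_of_nonneg (h.nonneg x)]
  have hK := hb.pos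
  rcases lt_or_ge (fstMarginal g x) 0 with h0 | h0
  · have : fstMarginal g x * (c * Real.exp (K * (‖x‖ ^ 2 + 2) / τ)) < 0 :=
      mul_neg_of_neg_of_pos h0 (by positivity)
    linarith [h.nonneg x]
  · refine hx.trans ?_
    gcongr

/-- Mass of the unweighted Gibbs density over a ball in the first variable. -/
def ballMass (b : Euc d × Euc d → ℝ) (τ : ℝ) (A : Euc d → ℝ) (r : ℝ) (y : Euc d) : ℝ :=
  ∫ x in Metric.closedBall 0 r, A x * gibbsKernel b τ (x, y)

theorem QuadraticCost.measurable_gibbsKernel_left (hb : QuadraticCost b K) (y : Euc d) :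
    Measurable fun x => gibbsKernel b τ (x, y) :=
  hb.continuous_gibbsKernel.measurable.comp (by fun_prop)

theorem IsGibbs.integrableOn_mul_kernel (h : IsGibbs b K τ u g A) (hb : QuadraticCost b K)
    (hτ : 0 < τ) (hg : Integrable g) (r : ℝ) (y : Euc d) :
    IntegrableOn (fun x => A x * gibbsKernel b τ (x, y)) (Metric.closedBall 0 r) := by
  refine (h.integrableOn_closedBall hb hτ hg r).mono'
    (h.meas.mul (hb.measurable_gibbsKernel_left y)).aestronglyMeasurable
    (Eventually.of_forall fun x => ?_)
  rw [Real.norm_eq_abs, abs_of_nonneg (mul_nonneg (h.nonneg x) (gibbsKernel_pos _ _ _).le)]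
  exact mul_le_of_le_one_right (h.nonneg x) (hb.gibbsKernel_le_one hτ _)

theorem QuadraticCost.measurable_fderiv (hb : QuadraticCost b K) :
    Measurable fun q : Euc d × Euc d => fderiv ℝ (fun y' => b (q.1, y')) q.2 :=
  measurable_fderiv_with_param ℝ (f := fun x y => b (x, y)) hb.cont

theorem QuadraticCost.measurable_fderiv_apply (hb : QuadraticCost b K) (v : Euc d) :
    Measurable fun q : Euc d × Euc d => fderiv ℝ (fun y' => b (q.1, y')) q.2 v :=
  (ContinuousLinearMap.measurable_apply v).comp hb.measurable_fderiv

theorem QuadraticCost.hasFDerivAt_gibbsKernel (hb : QuadraticCost b K) (x y : Euc d) :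
    HasFDerivAt (fun y' => gibbsKernel b τ (x, y'))
      ((-(gibbsKernel b τ (x, y)) / τ) • fderiv ℝ (fun y' => b (x, y')) y) y := by
  have h := (((hb.diff x) y).hasFDerivAt.neg.mul_const τ⁻¹).exp
  have e : (fun y' => gibbsKernel b τ (x, y')) = fun y' => Real.exp (-b (x, y') * τ⁻¹) := by
    ext y'; rw [gibbsKernel, div_eq_mul_inv]
  rw [e]
  refine h.congr_fderiv ?_
  ext v
  simp only [gibbsKernel, smul_apply, neg_apply, Pi.neg_apply, smul_eq_mul, div_eq_mul_inv]
  ring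

theorem IsGibbs.hasFDerivAt_ballMass (h : IsGibbs b K τ u g A) (hb : QuadraticCost b K)
    (hτ : 0 < τ) (hg : Integrable g) (r : ℝ) (y : Euc d) :
    Integrable (fun x => (A x * (-(gibbsKernel b τ (x, y)) / τ)) •
      fderiv ℝ (fun y' => b (x, y')) y) (volume.restrict (Metric.closedBall 0 r)) ∧
    HasFDerivAt (ballMass b τ A r) (∫ x in Metric.closedBall 0 r,
      (A x * (-(gibbsKernel b τ (x, y)) / τ)) • fderiv ℝ (fun y' => b (x, y')) y) y := by
  have hK := hb.pos
  have hmeas : AEStronglyMeasurable (fun x => (A x * (-(gibbsKernel b τ (x, y)) / τ)) •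
      fderiv ℝ (fun y' => b (x, y')) y) (volume.restrict (Metric.closedBall 0 r)) := by
    have h1 : Measurable fun x => fderiv ℝ (fun y' => b (x, y')) y :=
      hb.measurable_fderiv.comp (measurable_id.prodMk measurable_const)
    exact ((h.meas.mul ((hb.measurable_gibbsKernel_left y).neg.div_const τ)).smul
      h1).aestronglyMeasurable
  have hbd : ∀ᵐ x ∂(volume.restrict (Metric.closedBall (0 : Euc d) r)),
      ∀ y' ∈ Metric.ball y 1, ‖(A x * (-(gibbsKernel b τ (x, y')) / τ)) •
        fderiv ℝ (fun y' => b (x, y')) y'‖ ≤ A x * (τ⁻¹ * (K * (r ^ 2 + (‖y‖ + 1) ^ 2 + 1))) := by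
    filter_upwards [ae_restrict_mem Metric.isClosed_closedBall.measurableSet] with x hx y' hy'
    have hx' : ‖x‖ ≤ r := by simpa using hx
    have hy2 : ‖y'‖ ≤ ‖y‖ + 1 := by
      have := norm_le_norm_add_norm_sub' y' y
      have := mem_ball_iff_norm.1 hy'
      linarith
    rw [norm_smul, Real.norm_eq_abs, abs_mul, abs_of_nonneg (h.nonneg x), mul_assoc]
    refine mul_le_mul_of_nonneg_left (mul_le_mul ?_ ?_ (norm_nonneg _) (by positivity))
      (h.nonneg x)
    · rw [abs_div, abs_neg, abs_of_pos (gibbsKernel_pos _ _ _), abs_of_pos hτ, div_eq_mul_inv]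
      exact mul_le_of_le_one_left (by positivity) (hb.gibbsKernel_le_one hτ _)
    · refine (hb.norm_fderiv_le x y').trans ?_
      gcongr
  have hbi := (h.integrableOn_closedBall hb hτ hg r).mul_const
    (τ⁻¹ * (K * (r ^ 2 + (‖y‖ + 1) ^ 2 + 1)))
  refine ⟨hbi.mono' hmeas (hbd.mono fun x hx => hx y (Metric.mem_ball_self one_pos)), ?_⟩
  refine hasFDerivAt_integral_of_dominated_of_fderiv_le
    (F := fun y' x => A x * gibbsKernel b τ (x, y'))
    (F' := fun y' x => (A x * (-(gibbsKernel b τ (x, y')) / τ)) •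
      fderiv ℝ (fun y' => b (x, y')) y')
    (Metric.ball_mem_nhds y one_pos) (Eventually.of_forall fun y' =>
    (h.meas.mul (hb.measurable_gibbsKernel_left y')).aestronglyMeasurable)
    (h.integrableOn_mul_kernel hb hτ hg r y) hmeas hbd hbi
    (Eventually.of_forall fun x y' _ => ?_)
  rw [← smul_smul]
  exact (hb.hasFDerivAt_gibbsKernel x y').const_mul (A x)

theorem IsGibbs.differentiable_ballMass (h : IsGibbs b K τ u g A) (hb : QuadraticCost b K)
    (hτ : 0 < τ) (hg : Integrable g) (r : ℝ) : Differentiable ℝ (ballMass b τ A r) :=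
  fun y => (h.hasFDerivAt_ballMass hb hτ hg r y).2.differentiableAt

theorem IsGibbs.fderiv_ballMass_apply (h : IsGibbs b K τ u g A) (hb : QuadraticCost b K)
    (hτ : 0 < τ) (hg : Integrable g) (r : ℝ) (y v : Euc d) :
    τ * fderiv ℝ (ballMass b τ A r) y v = -∫ x in Metric.closedBall 0 r,
      A x * gibbsKernel b τ (x, y) * fderiv ℝ (fun y' => b (x, y')) y v := by
  obtain ⟨hi, hd⟩ := h.hasFDerivAt_ballMass hb hτ hg r y
  rw [hd.fderiv, ContinuousLinearMap.integral_apply hi, ← integral_const_mul, ← integral_neg]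
  refine integral_congr_ae (Eventually.of_forall fun x => ?_)
  simp only [smul_apply, smul_eq_mul]
  field_simp

theorem IsGibbs.integrableOn_mul_kernel_quadratic (h : IsGibbs b K τ u g A)
    (hb : QuadraticCost b K) (hτ : 0 < τ) (hg : Integrable g) (r : ℝ) (y : Euc d) :
    IntegrableOn (fun x => A x * gibbsKernel b τ (x, y) * (‖x‖ ^ 2 + ‖y‖ ^ 2 + 1))
      (Metric.closedBall 0 r) := by
  refine ((h.integrableOn_mul_kernel hb hτ hg r y).mul_const (r ^ 2 + ‖y‖ ^ 2 + 1)).mono'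
    ((h.meas.mul (hb.measurable_gibbsKernel_left y)).mul
      (by fun_prop)).aestronglyMeasurable ?_
  filter_upwards [ae_restrict_mem Metric.isClosed_closedBall.measurableSet] with x hx
  have hx' : ‖x‖ ≤ r := by simpa using hx
  have h0 := mul_nonneg (h.nonneg x) (gibbsKernel_pos b τ (x, y)).le
  rw [Real.norm_eq_abs, abs_of_nonneg (by positivity)]
  gcongr

theorem IsGibbs.abs_fderiv_ballMass_le (h : IsGibbs b K τ u g A) (hb : QuadraticCost b K)
    (hτ : 0 < τ) (hg : Integrable g) (r : ℝ) (y v : Euc d) :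
    |τ * fderiv ℝ (ballMass b τ A r) y v| ≤ K * ‖v‖ * ∫ x in Metric.closedBall 0 r,
      A x * gibbsKernel b τ (x, y) * (‖x‖ ^ 2 + ‖y‖ ^ 2 + 1) := by
  rw [h.fderiv_ballMass_apply hb hτ hg, abs_neg, ← integral_const_mul, ← Real.norm_eq_abs]
  refine norm_integral_le_of_norm_le
    ((h.integrableOn_mul_kernel_quadratic hb hτ hg r y).const_mul _)
    (Eventually.of_forall fun x => ?_)
  have h0 := mul_nonneg (h.nonneg x) (gibbsKernel_pos b τ (x, y)).le
  rw [norm_mul, Real.norm_eq_abs, abs_of_nonneg h0]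
  have h1 := ((fderiv ℝ (fun y' => b (x, y')) y).le_opNorm v).trans
    (mul_le_mul_of_nonneg_right (hb.norm_fderiv_le x y) (norm_nonneg v))
  refine (mul_le_mul_of_nonneg_left h1 h0).trans_eq ?_
  ring

theorem IsGibbs.integral_quadratic_le_ballMass (h : IsGibbs b K τ u g A)
    (hb : QuadraticCost b K) (hτ : 0 < τ) (hg : Integrable g) (r : ℝ) (y : Euc d) :
    ∫ x in Metric.closedBall 0 r, A x * gibbsKernel b τ (x, y) * (‖x‖ ^ 2 + ‖y‖ ^ 2 + 1) ≤
      (r ^ 2 + ‖y‖ ^ 2 + 1) * ballMass b τ A r y := by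
  rw [ballMass, ← integral_const_mul]
  refine setIntegral_mono_on (h.integrableOn_mul_kernel_quadratic hb hτ hg r y)
    ((h.integrableOn_mul_kernel hb hτ hg r y).const_mul _)
    Metric.isClosed_closedBall.measurableSet fun x hx => ?_
  have hx' : ‖x‖ ≤ r := by simpa using hx
  have h0 := mul_nonneg (h.nonneg x) (gibbsKernel_pos b τ (x, y)).le
  rw [mul_comm]
  gcongr

theorem IsGibbs.eventually_ballMass_pos (h : IsGibbs b K τ u g A) (hb : QuadraticCost b K)
    (hτ : 0 < τ) (hg : Integrable g) (hpos : 0 < ∫ q, g q) :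
    ∀ᶠ k : ℕ in atTop, ∀ y, 0 < ballMass b τ A k y := by
  have hsupp : ∃ k : ℕ, 0 < volume (Function.support A ∩ Metric.closedBall (0 : Euc d) k) := by
    by_contra! hcon
    have hA : ∀ᵐ x, A x = 0 := by
      have h1 : volume (⋃ k : ℕ, Function.support A ∩ Metric.closedBall (0 : Euc d) k) = 0 :=
        measure_iUnion_null fun k => le_antisymm (hcon k) zero_le
      rw [← Set.inter_iUnion, Metric.iUnion_closedBall_nat, Set.inter_univ] at h1
      exact measure_eq_zero_iff_ae_notMem.1 h1 |>.mono fun x hx => by simpa using hx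
    refine hpos.ne' (integral_eq_zero_of_ae ?_)
    filter_upwards [h.eq, (Measure.quasiMeasurePreserving_fst (μ := (volume : Measure (Euc d)))
      (ν := (volume : Measure (Euc d)))).ae hA] with q h1 h2
    rw [h1, h2, zero_mul, Pi.zero_apply]
  obtain ⟨k, hk⟩ := hsupp
  filter_upwards [eventually_ge_atTop k] with l hl y
  rw [ballMass, setIntegral_pos_iff_support_of_nonneg_ae
    (Eventually.of_forall fun x => mul_nonneg (h.nonneg x) (gibbsKernel_pos b τ (x, y)).le)
    (h.integrableOn_mul_kernel hb hτ hg l y)]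
  refine hk.trans_le (measure_mono fun x hx => ⟨?_, ?_⟩)
  · exact mul_ne_zero hx.1 (gibbsKernel_pos _ _ _).ne'
  · exact Metric.closedBall_subset_closedBall (by exact_mod_cast hl) hx.2

/-- Restricting a measure to a ball decreases the average of `‖x‖ ^ 2`. -/
theorem setIntegral_closedBall_mul_integral_le {ρ : Euc d → ℝ} (h0 : ∀ x, 0 ≤ ρ x)
    (hρ : Integrable ρ) {a : ℝ} (hρ2 : Integrable fun x => ρ x * (‖x‖ ^ 2 + a)) {r : ℝ} :
    (∫ x in Metric.closedBall 0 r, ρ x * (‖x‖ ^ 2 + a)) * (∫ x, ρ x) ≤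
      (∫ x, ρ x * (‖x‖ ^ 2 + a)) * ∫ x in Metric.closedBall 0 r, ρ x := by
  set B := Metric.closedBall (0 : Euc d) r
  have hB : MeasurableSet B := Metric.isClosed_closedBall.measurableSet
  rcases lt_or_ge r 0 with hr | hr
  · have : B = ∅ := Metric.closedBall_eq_empty.2 hr
    simp [this]
  rw [← integral_add_compl hB hρ, ← integral_add_compl hB hρ2]
  have h1 : ∫ x in B, ρ x * (‖x‖ ^ 2 + a) ≤ (∫ x in B, ρ x) * (r ^ 2 + a) := by
    rw [← integral_mul_const]
    refine setIntegral_mono_on hρ2.integrableOn (hρ.integrableOn.mul_const _) hB fun x hx => ?_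
    have hx' : ‖x‖ ≤ r := by simpa [B] using hx
    have := h0 x
    gcongr
  have h2 : (∫ x in Bᶜ, ρ x) * (r ^ 2 + a) ≤ ∫ x in Bᶜ, ρ x * (‖x‖ ^ 2 + a) := by
    rw [← integral_mul_const]
    refine setIntegral_mono_on (hρ.integrableOn.mul_const _) hρ2.integrableOn hB.compl
      fun x hx => ?_
    have hx' : r < ‖x‖ := by simpa [B] using hx
    have := h0 x
    gcongr
  have h3 : 0 ≤ ∫ x in B, ρ x := integral_nonneg h0
  have h4 : 0 ≤ ∫ x in Bᶜ, ρ x := integral_nonneg h0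
  have h5 := mul_le_mul_of_nonneg_right h1 h4
  have h6 := mul_le_mul_of_nonneg_right h2 h3
  nlinarith

end BallMass


section IntegrationByParts

variable {d : ℕ} {u : ℝ → ℝ} {b g : Euc d × Euc d → ℝ} {A : Euc d → ℝ} {K τ : ℝ}

theorem IsGibbs.integral_ballMass_mul_fderiv (h : IsGibbs b K τ u g A) (hb : QuadraticCost b K)
    (hτ : 0 < τ) (hg : Integrable g) {Ξ P : ℝ → ℝ} (hΞ : Continuous Ξ)
    (hP : ∀ s, HasDerivAt P (Ξ s) s) {r : ℝ} (hr : ∀ y, 0 < ballMass b τ A r y)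
    {φ : Euc d → ℝ} (hφ : ContDiff ℝ 1 φ) (hφc : HasCompactSupport φ) (v : Euc d) :
    ∫ y, P (τ * Real.log (ballMass b τ A r y)) * fderiv ℝ φ y v =
      ∫ y, -(Ξ (τ * Real.log (ballMass b τ A r y)) * (ballMass b τ A r y)⁻¹ *
        (τ * fderiv ℝ (ballMass b τ A r) y v)) * φ y := by
  have hκ := h.differentiable_ballMass hb hτ hg r
  have hL : ∀ y, HasFDerivAt (fun y => τ * Real.log (ballMass b τ A r y))
      (τ • ((ballMass b τ A r y)⁻¹ • fderiv ℝ (ballMass b τ A r) y)) y := fun y =>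
    ((hκ y).hasFDerivAt.log (hr y).ne').const_mul τ
  have hQ : ∀ y, HasFDerivAt (fun y => P (τ * Real.log (ballMass b τ A r y)))
      (Ξ (τ * Real.log (ballMass b τ A r y)) • (τ • ((ballMass b τ A r y)⁻¹ •
        fderiv ℝ (ballMass b τ A r) y))) y := fun y =>
    (hP _).comp_hasFDerivAt y (hL y)
  have hLc : Continuous fun y => τ * Real.log (ballMass b τ A r y) :=
    continuous_iff_continuousAt.2 fun y => (hL y).continuousAt
  have hQc : Continuous fun y => P (τ * Real.log (ballMass b τ A r y)) :=
    continuous_iff_continuousAt.2 fun y => (hQ y).continuousAt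
  have hQv : ∀ y, fderiv ℝ (fun y => P (τ * Real.log (ballMass b τ A r y))) y v =
      Ξ (τ * Real.log (ballMass b τ A r y)) * (ballMass b τ A r y)⁻¹ *
        (τ * fderiv ℝ (ballMass b τ A r) y v) := fun y => by
    rw [(hQ y).fderiv]
    simp only [smul_apply, smul_eq_mul]
    ring
  have hφ' : Continuous fun y => fderiv ℝ φ y v :=
    (hφ.continuous_fderiv one_ne_zero).clm_apply continuous_const
  have hφ'c : HasCompactSupport fun y => fderiv ℝ φ y v := hφc.fderiv_apply (𝕜 := ℝ) v
  have i1 : Integrable fun y => P (τ * Real.log (ballMass b τ A r y)) * fderiv ℝ φ y v :=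
    (hQc.mul hφ').integrable_of_hasCompactSupport hφ'c.mul_left
  have i2 : Integrable fun y => P (τ * Real.log (ballMass b τ A r y)) * φ y :=
    (hQc.mul hφ.continuous).integrable_of_hasCompactSupport hφc.mul_left
  have i3 : Integrable fun y =>
      fderiv ℝ (fun y => P (τ * Real.log (ballMass b τ A r y))) y v * φ y := by
    have hmaj : Integrable fun y => |Ξ (τ * Real.log (ballMass b τ A r y))| *
        (K * ‖v‖ * (r ^ 2 + ‖y‖ ^ 2 + 1)) * |φ y| := by
      refine Continuous.integrable_of_hasCompactSupport ?_ hφc.norm.mul_left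
      have := hφ.continuous
      have := hΞ.comp hLc
      fun_prop
    refine hmaj.mono' (((measurable_fderiv_apply_const ℝ _ v).mul
      hφ.continuous.measurable).aestronglyMeasurable) (Eventually.of_forall fun y => ?_)
    rw [hQv, norm_mul, Real.norm_eq_abs, Real.norm_eq_abs, abs_mul, abs_mul, mul_assoc |_|]
    refine mul_le_mul_of_nonneg_right (mul_le_mul_of_nonneg_left ?_ (abs_nonneg _))
      (abs_nonneg _)
    have hK := hb.pos
    have h1 := (h.abs_fderiv_ballMass_le hb hτ hg r y v).trans
      (mul_le_mul_of_nonneg_left (h.integral_quadratic_le_ballMass hb hτ hg r y) (by positivity))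
    rw [abs_of_pos (inv_pos.2 (hr y)), inv_mul_le_iff₀ (hr y)]
    linarith
  rw [integral_mul_fderiv_eq_neg_fderiv_mul_of_integrable i3 i1 i2
    (fun y _ => (hQ y).differentiableAt) (fun y _ => hφ.differentiable one_ne_zero y),
    ← integral_neg]
  refine integral_congr_ae (Eventually.of_forall fun y => ?_)
  simp only [hQv, neg_mul]

/-- For almost every `y`, the Gibbs identity on the section over `y`. -/
theorem IsGibbs.ae_section_left (h : IsGibbs b K τ u g A) (hg : Admissible u g) :
    ∀ᵐ y : Euc d,
      (∀ᵐ x, g (x, y) = A x * gibbsKernel b τ (x, y) * gibbsWeight τ u g y) ∧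
      Integrable (fun x => A x * gibbsKernel b τ (x, y)) ∧
      Integrable (fun x => A x * gibbsKernel b τ (x, y) * (‖x‖ ^ 2 + (‖y‖ ^ 2 + 1))) ∧
      (∫ x, A x * gibbsKernel b τ (x, y)) * gibbsWeight τ u g y = sndMarginal g y ∧
      (∫ x, A x * gibbsKernel b τ (x, y) * (‖x‖ ^ 2 + (‖y‖ ^ 2 + 1))) * gibbsWeight τ u g y =
        sndMarginal (fun q => (‖q.1‖ ^ 2 + ‖q.2‖ ^ 2) * g q + g q) y ∧
      0 < ∫ x, A x * gibbsKernel b τ (x, y) := by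
  have heq : ∀ᵐ y : Euc d, ∀ᵐ x : Euc d,
      g (x, y) = A x * (gibbsKernel b τ (x, y) * gibbsWeight τ u g y) :=
    Measure.ae_ae_of_ae_prod (p := fun q : Euc d × Euc d =>
      g q.swap = A q.2 * (gibbsKernel b τ q.swap * gibbsWeight τ u g q.1))
      ((Measure.measurePreserving_swap (μ := volume) (ν := volume)).quasiMeasurePreserving.ae
        h.eq)
  filter_upwards [heq, ae_integrable_left hg.integrable,
    ae_integrable_left (hg.moment.add hg.integrable), h.pos] with y hy hi hi2 hpos
  have hw := gibbsWeight_pos τ u g y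
  have h1 : ∀ᵐ x, g (x, y) = A x * gibbsKernel b τ (x, y) * gibbsWeight τ u g y :=
    hy.mono fun x hx => by rw [hx]; ring
  have h2 : ∀ᵐ x, (‖x‖ ^ 2 + ‖y‖ ^ 2) * g (x, y) + g (x, y) =
      A x * gibbsKernel b τ (x, y) * (‖x‖ ^ 2 + (‖y‖ ^ 2 + 1)) * gibbsWeight τ u g y :=
    h1.mono fun x hx => by rw [hx]; ring
  have e1 : (∫ x, A x * gibbsKernel b τ (x, y)) * gibbsWeight τ u g y = sndMarginal g y := by
    rw [← integral_mul_const, sndMarginal]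
    exact (integral_congr_ae h1).symm
  refine ⟨h1, ?_, ?_, e1, ?_, ?_⟩
  · refine (hi.mul_const (gibbsWeight τ u g y)⁻¹).congr ?_
    filter_upwards [h1] with x hx
    rw [hx, mul_inv_cancel_right₀ hw.ne']
  · refine (hi2.mul_const (gibbsWeight τ u g y)⁻¹).congr ?_
    filter_upwards [h2] with x hx
    simp only [Pi.add_apply]
    rw [hx, mul_inv_cancel_right₀ hw.ne']
  · rw [← integral_mul_const, sndMarginal]
    exact (integral_congr_ae h2).symm
  · rw [← e1] at hpos
    exact pos_of_mul_pos_left hpos hw.le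

theorem tendsto_setIntegral_closedBall {F : Euc d → ℝ} (hF : Integrable F) :
    Tendsto (fun k : ℕ => ∫ x in Metric.closedBall (0 : Euc d) k, F x) atTop (𝓝 (∫ x, F x)) := by
  have := tendsto_setIntegral_of_monotone (μ := volume) (f := F)
    (s := fun k : ℕ => Metric.closedBall (0 : Euc d) k)
    (fun k => Metric.isClosed_closedBall.measurableSet)
    (fun k l hkl => Metric.closedBall_subset_closedBall (by exact_mod_cast hkl)) hF.integrableOn
  rwa [Metric.iUnion_closedBall_nat, setIntegral_univ] at this

theorem QuadraticCost.integrable_mul_fderiv (hb : QuadraticCost b K) (hg : Admissible u g)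
    (v : Euc d) :
    Integrable fun q : Euc d × Euc d => g q * fderiv ℝ (fun y' => b (q.1, y')) q.2 v := by
  refine ((hg.moment.add hg.integrable).const_mul (K * ‖v‖)).mono'
    (hg.meas.mul (hb.measurable_fderiv_apply v)).aestronglyMeasurable
    (Eventually.of_forall fun q => ?_)
  rw [norm_mul, Real.norm_eq_abs, abs_of_nonneg (hg.nonneg q)]
  have h1 := ((fderiv ℝ (fun y' => b (q.1, y')) q.2).le_opNorm v).trans
    (mul_le_mul_of_nonneg_right (hb.norm_fderiv_le q.1 q.2) (norm_nonneg v))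
  refine (mul_le_mul_of_nonneg_left h1 (hg.nonneg q)).trans_eq ?_
  simp only [Pi.add_apply]; ring

set_option maxHeartbeats 1000000 in
/-- Integration by parts for the sum of the entropic and internal pressures. -/
theorem IsGibbs.integral_pressure_mul_fderiv (h : IsGibbs b K τ u g A) (hu : EnergyDensity u)
    (hb : QuadraticCost b K) (hτ : 0 < τ) (hg : Admissible u g) (hpos : 0 < ∫ q, g q)
    (hpress : Integrable fun y => press u (sndMarginal g y))
    {φ : Euc d → ℝ} (hφ : ContDiff ℝ 1 φ) (hφc : HasCompactSupport φ) (v : Euc d) :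
    ∫ y, (τ * sndMarginal g y + press u (sndMarginal g y)) * fderiv ℝ φ y v =
      ∫ q : Euc d × Euc d, g q * fderiv ℝ (fun y' => b (q.1, y')) q.2 v * φ q.2 := by
  obtain ⟨Ξ, hΞ0, hΞ1, hΞ2, hΞc, hΞm, hΞd⟩ := hu.exists_inverse hτ
  set P : ℝ → ℝ := fun s => τ * Ξ s + press u (Ξ s) with hP
  have hP0 : ∀ s, 0 ≤ P s := fun s =>
    add_nonneg (mul_nonneg hτ.le (hΞ0 s).le) (hu.press_nonneg (hΞ0 s).le)
  have hPm : Monotone P := monotone_of_hasDerivAt_nonneg hΞd fun s => (hΞ0 s).le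
  have hPc : Continuous P := continuous_iff_continuousAt.2 fun s => (hΞd s).continuousAt
  have hφ' : Continuous fun y => fderiv ℝ φ y v :=
    (hφ.continuous_fderiv one_ne_zero).clm_apply continuous_const
  have hφ'c : HasCompactSupport fun y => fderiv ℝ φ y v := hφc.fderiv_apply (𝕜 := ℝ) v
  obtain ⟨B', hB'⟩ := hφ'c.exists_bound_of_continuous hφ'
  obtain ⟨B, hB⟩ := hφc.exists_bound_of_continuous hφ.continuous
  have hDg := hb.integrable_mul_fderiv hg v
  have hDφ : Integrable fun q : Euc d × Euc d =>
      g q * fderiv ℝ (fun y' => b (q.1, y')) q.2 v * φ q.2 :=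
    hDg.mul_bdd (c := B) (hφ.continuous.comp continuous_snd).aestronglyMeasurable
      (Eventually.of_forall fun q => hB q.2)
  have hrhs : ∫ q : Euc d × Euc d, g q * fderiv ℝ (fun y' => b (q.1, y')) q.2 v * φ q.2 =
      ∫ y, sndMarginal (fun q => g q * fderiv ℝ (fun y' => b (q.1, y')) q.2 v) y * φ y := by
    rw [← integral_sndMarginal hDφ]
    exact integral_congr_ae (Eventually.of_forall fun y => integral_mul_const (φ y)
      fun x => g (x, y) * fderiv ℝ (fun y' => b (x, y')) y v)
  rw [hrhs]
  have hsec := h.ae_section_left hg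
  have hκm : ∀ k : ℕ, Measurable (ballMass b τ A k) := fun k =>
    (h.differentiable_ballMass hb hτ hg.integrable k).continuous.measurable
  have hpos' := h.eventually_ballMass_pos hb hτ hg.integrable hpos
  have hκle : ∀ y, Integrable (fun x => A x * gibbsKernel b τ (x, y)) → ∀ k : ℕ,
      ballMass b τ A k y ≤ ∫ x, A x * gibbsKernel b τ (x, y) := fun y hy k =>
    setIntegral_le_integral hy (Eventually.of_forall fun x =>
      mul_nonneg (h.nonneg x) (gibbsKernel_pos b τ (x, y)).le)
  have hval : ∀ᵐ y : Euc d, τ * Real.log (∫ x, A x * gibbsKernel b τ (x, y)) =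
      τ * Real.log (sndMarginal g y) + deriv u (sndMarginal g y) := by
    filter_upwards [hsec] with y ⟨_, _, _, h4, _, h6⟩
    have e : Real.log (sndMarginal g y) = Real.log (∫ x, A x * gibbsKernel b τ (x, y)) +
        Real.log (gibbsWeight τ u g y) := by
      rw [← h4, Real.log_mul h6.ne' (gibbsWeight_pos _ _ _ _).ne']
    rw [e, gibbsWeight, Real.log_exp]
    field_simp
    ring
  have hL1 : Tendsto (fun k : ℕ => ∫ y, P (τ * Real.log (ballMass b τ A k y)) * fderiv ℝ φ y v)
      atTop (𝓝 (∫ y, (τ * sndMarginal g y + press u (sndMarginal g y)) * fderiv ℝ φ y v)) := by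
    refine tendsto_integral_filter_of_dominated_convergence
      (fun y => (τ * sndMarginal g y + press u (sndMarginal g y)) * B')
      (Eventually.of_forall fun k => ((hPc.measurable.comp
        ((Real.measurable_log.comp (hκm k)).const_mul τ)).mul
        hφ'.measurable).aestronglyMeasurable) ?_
      (((((integrable_sndMarginal hg.integrable).const_mul τ).add hpress)).mul_const B') ?_
    · filter_upwards [hpos'] with k hk
      filter_upwards [hsec, h.pos, hval] with y ⟨_, h2, _, h4, _, h6⟩ hn hv
      rw [norm_mul, Real.norm_eq_abs, abs_of_nonneg (hP0 _)]
      have h7 : P (τ * Real.log (ballMass b τ A k y)) ≤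
          P (τ * Real.log (∫ x, A x * gibbsKernel b τ (x, y))) :=
        hPm (mul_le_mul_of_nonneg_left (Real.log_le_log (hk y) (hκle y h2 k)) hτ.le)
      have h8 : P (τ * Real.log (∫ x, A x * gibbsKernel b τ (x, y))) =
          τ * sndMarginal g y + press u (sndMarginal g y) := by
        simp only [hP]
        rw [hv, hΞ1 _ hn]
      rw [h8] at h7
      exact mul_le_mul h7 (hB' y) (norm_nonneg _) ((hP0 _).trans h7)
    · filter_upwards [hsec, h.pos, hval] with y ⟨_, h2, _, h4, _, h6⟩ hn hv
      have h8 : P (τ * Real.log (∫ x, A x * gibbsKernel b τ (x, y))) =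
          τ * sndMarginal g y + press u (sndMarginal g y) := by
        simp only [hP]
        rw [hv, hΞ1 _ hn]
      rw [← h8]
      exact ((hPc.tendsto _).comp (((tendsto_setIntegral_closedBall h2).log h6.ne').const_mul
        τ)).mul_const _
  have hL2 : Tendsto (fun k : ℕ => ∫ y, -(Ξ (τ * Real.log (ballMass b τ A k y)) *
      (ballMass b τ A k y)⁻¹ * (τ * fderiv ℝ (ballMass b τ A k) y v)) * φ y) atTop
      (𝓝 (∫ y, sndMarginal (fun q => g q * fderiv ℝ (fun y' => b (q.1, y')) q.2 v) y * φ y)) := by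
    refine tendsto_integral_filter_of_dominated_convergence
      (fun y => K * ‖v‖ * sndMarginal (fun q => (‖q.1‖ ^ 2 + ‖q.2‖ ^ 2) * g q + g q) y * B)
      (Eventually.of_forall fun k => ((((hΞc.measurable.comp
        ((Real.measurable_log.comp (hκm k)).const_mul τ)).mul (hκm k).inv).mul
        ((measurable_fderiv_apply_const ℝ _ v).const_mul τ)).neg.mul
        hφ.continuous.measurable).aestronglyMeasurable) ?_
      (((integrable_sndMarginal (hg.moment.add hg.integrable)).const_mul _).mul_const B) ?_
    · filter_upwards [hpos'] with k hk
      filter_upwards [hsec, h.pos, hval] with y ⟨_, h2, h3, h4, h5, h6⟩ hn hv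
      have hK := hb.pos
      have h7 : Ξ (τ * Real.log (ballMass b τ A k y)) ≤ sndMarginal g y := by
        rw [← hΞ1 _ hn, ← hv]
        exact hΞm (mul_le_mul_of_nonneg_left (Real.log_le_log (hk y) (hκle y h2 k)) hτ.le)
      have h8 := h.abs_fderiv_ballMass_le hb hτ hg.integrable k y v
      have h9 := setIntegral_closedBall_mul_integral_le (r := k) (fun x =>
        mul_nonneg (h.nonneg x) (gibbsKernel_pos b τ (x, y)).le) h2 h3
      simp only [← add_assoc] at h9 h5
      set I := ∫ x in Metric.closedBall 0 (k : ℝ),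
        A x * gibbsKernel b τ (x, y) * (‖x‖ ^ 2 + ‖y‖ ^ 2 + 1) with hI
      set J := ∫ x, A x * gibbsKernel b τ (x, y) * (‖x‖ ^ 2 + ‖y‖ ^ 2 + 1) with hJ
      have hI0 : 0 ≤ I := integral_nonneg fun x =>
        mul_nonneg (mul_nonneg (h.nonneg x) (gibbsKernel_pos b τ (x, y)).le) (by positivity)
      have h10 : (ballMass b τ A k y)⁻¹ * I * (∫ x, A x * gibbsKernel b τ (x, y)) ≤ J := by
        rw [mul_assoc, inv_mul_le_iff₀ (hk y), mul_comm (ballMass b τ A k y)]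
        exact h9
      rw [norm_mul, norm_neg, norm_mul, norm_mul, Real.norm_eq_abs, Real.norm_eq_abs,
        Real.norm_eq_abs, abs_of_pos (hΞ0 _), abs_of_pos (inv_pos.2 (hk y))]
      refine mul_le_mul ?_ (hB y) (norm_nonneg _) ?_
      · calc Ξ (τ * Real.log (ballMass b τ A k y)) * (ballMass b τ A k y)⁻¹ *
              |τ * fderiv ℝ (ballMass b τ A k) y v|
            ≤ sndMarginal g y * (ballMass b τ A k y)⁻¹ * (K * ‖v‖ * I) := by
              have := inv_pos.2 (hk y)
              gcongr
          _ = K * ‖v‖ * (((ballMass b τ A k y)⁻¹ * I * (∫ x, A x * gibbsKernel b τ (x, y))) *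
                gibbsWeight τ u g y) := by rw [← h4]; ring
          _ ≤ K * ‖v‖ * (J * gibbsWeight τ u g y) := by
              have := (gibbsWeight_pos τ u g y).le
              gcongr
          _ = _ := by rw [h5]
      · rw [← h5]
        have : 0 ≤ J := integral_nonneg fun x =>
          mul_nonneg (mul_nonneg (h.nonneg x) (gibbsKernel_pos b τ (x, y)).le) (by positivity)
        have := (gibbsWeight_pos τ u g y).le
        positivity
    · filter_upwards [hsec, h.pos, hval, ae_integrable_left hDg] with
        y ⟨h1, h2, h3, h4, h5, h6⟩ hn hv hDy
      have hw := gibbsWeight_pos τ u g y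
      have hD1 : ∀ᵐ x, g (x, y) * fderiv ℝ (fun y' => b (x, y')) y v =
          A x * gibbsKernel b τ (x, y) * fderiv ℝ (fun y' => b (x, y')) y v *
            gibbsWeight τ u g y := h1.mono fun x hx => by rw [hx]; ring
      have hDi : Integrable fun x =>
          A x * gibbsKernel b τ (x, y) * fderiv ℝ (fun y' => b (x, y')) y v := by
        refine (hDy.mul_const (gibbsWeight τ u g y)⁻¹).congr ?_
        filter_upwards [hD1] with x hx
        rw [hx, mul_inv_cancel_right₀ hw.ne']
      have hlim := tendsto_setIntegral_closedBall hDi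
      have hκlim := tendsto_setIntegral_closedBall h2
      have hΞlim : Tendsto (fun k : ℕ => Ξ (τ * Real.log (ballMass b τ A k y))) atTop
          (𝓝 (sndMarginal g y)) := by
        rw [← hΞ1 _ hn, ← hv]
        exact (hΞc.tendsto _).comp ((hκlim.log h6.ne').const_mul τ)
      have hfin := (((hΞlim.mul (hκlim.inv₀ h6.ne')).mul hlim)).mul_const (φ y)
      have e : sndMarginal g y * (∫ x, A x * gibbsKernel b τ (x, y))⁻¹ *
          (∫ x, A x * gibbsKernel b τ (x, y) * fderiv ℝ (fun y' => b (x, y')) y v) =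
          sndMarginal (fun q => g q * fderiv ℝ (fun y' => b (q.1, y')) q.2 v) y := by
        have : sndMarginal (fun q => g q * fderiv ℝ (fun y' => b (q.1, y')) q.2 v) y =
            (∫ x, A x * gibbsKernel b τ (x, y) * fderiv ℝ (fun y' => b (x, y')) y v) *
              gibbsWeight τ u g y := by
          rw [← integral_mul_const]
          exact integral_congr_ae hD1
        rw [this, ← h4]
        field_simp
      rw [e] at hfin
      refine hfin.congr fun k => ?_
      rw [h.fderiv_ballMass_apply hb hτ hg.integrable, mul_neg, neg_neg, ballMass]
  refine tendsto_nhds_unique hL1 (hL2.congr' ?_)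
  filter_upwards [hpos'] with k hk
  exact (h.integral_ballMass_mul_fderiv hb hτ hg.integrable hΞc hΞd hk hφ hφc v).symm

end IntegrationByParts


section Divergence

variable {d : ℕ} {u : ℝ → ℝ} {b g : Euc d × Euc d → ℝ} {K τ : ℝ}

theorem divg_eq_sum {η : Euc d → Euc d} (hη : Differentiable ℝ η) (y : Euc d) :
    divg η y = ∑ i, fderiv ℝ (fun y => ⟪EuclideanSpace.basisFun (Fin d) ℝ i, η y⟫) y
      (EuclideanSpace.basisFun (Fin d) ℝ i) := by
  rw [divg, LinearMap.trace_eq_sum_inner _ (EuclideanSpace.basisFun (Fin d) ℝ)]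
  refine Finset.sum_congr rfl fun i _ => ?_
  rw [fderiv_inner_apply ℝ (differentiableAt_const _) (hη y)]
  simp

theorem clm_apply_eq_sum (D : Euc d →L[ℝ] ℝ) (w : Euc d) :
    D w = ∑ i, D (EuclideanSpace.basisFun (Fin d) ℝ i) *
      ⟪EuclideanSpace.basisFun (Fin d) ℝ i, w⟫ := by
  conv_lhs => rw [← (EuclideanSpace.basisFun (Fin d) ℝ).sum_repr' w, map_sum]
  refine Finset.sum_congr rfl fun i _ => ?_
  rw [map_smul, smul_eq_mul, mul_comm]

/-- Euler–Lagrange equation for minimising densities. -/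
theorem IsMinPlan.euler_lagrange (hg : IsMinPlan b τ u g) (hu : EnergyDensity u)
    (hb : QuadraticCost b K) (hτ : 0 < τ) (hpos : 0 < ∫ q, g q)
    (hent : Integrable fun x => fstMarginal g x * Real.log (fstMarginal g x))
    {η : Euc d → Euc d} (hη : ContDiff ℝ 1 η) (hηc : HasCompactSupport η) :
    τ * (∫ y, sndMarginal g y * divg η y) + ∫ y, press u (sndMarginal g y) * divg η y =
      ∫ q : Euc d × Euc d, g q * fderiv ℝ (fun y' => b (q.1, y')) q.2 (η q.2) := by
  obtain ⟨A, hA⟩ := hg.exists_isGibbs hu hb hτ hpos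
  have hpress := hA.integrable_press hu hb hτ hg.adm hent
  set e := EuclideanSpace.basisFun (Fin d) ℝ with he
  set φ : Fin d → Euc d → ℝ := fun i y => ⟪e i, η y⟫ with hφdef
  have hφ : ∀ i, ContDiff ℝ 1 (φ i) := fun i => contDiff_const.inner ℝ hη
  have hφc : ∀ i, HasCompactSupport (φ i) := fun i =>
    hηc.comp_left (g := fun w => ⟪e i, w⟫) (inner_zero_right _)
  have hdiv : ∀ y, divg η y = ∑ i, fderiv ℝ (φ i) y (e i) := fun y =>
    divg_eq_sum (hη.differentiable one_ne_zero) y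
  have hbdd : ∀ {F : Euc d → ℝ}, Integrable F → ∀ i,
      Integrable fun y => F y * fderiv ℝ (φ i) y (e i) := fun {F} hF i => by
    have hc : Continuous fun y => fderiv ℝ (φ i) y (e i) :=
      ((hφ i).continuous_fderiv one_ne_zero).clm_apply continuous_const
    obtain ⟨B, hB⟩ := ((hφc i).fderiv_apply (𝕜 := ℝ) (e i)).exists_bound_of_continuous hc
    exact hF.mul_bdd (c := B) hc.aestronglyMeasurable (Eventually.of_forall hB)
  have hn := integrable_sndMarginal hg.adm.integrable
  have hdivi : ∀ {F : Euc d → ℝ}, Integrable F → Integrable fun y => F y * divg η y :=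
    fun {F} hF => by
      simp only [hdiv, Finset.mul_sum]
      exact integrable_finsetSum _ fun i _ => hbdd hF i
  have e1 : τ * (∫ y, sndMarginal g y * divg η y) + ∫ y, press u (sndMarginal g y) * divg η y =
      ∫ y, (τ * sndMarginal g y + press u (sndMarginal g y)) * divg η y := by
    rw [← integral_const_mul, ← integral_add ((hdivi hn).const_mul τ) (hdivi hpress)]
    congr 1; ext y; ring
  have e2 : ∫ y, (τ * sndMarginal g y + press u (sndMarginal g y)) * divg η y =
      ∑ i, ∫ y, (τ * sndMarginal g y + press u (sndMarginal g y)) * fderiv ℝ (φ i) y (e i) := by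
    simp only [hdiv, Finset.mul_sum]
    exact integral_finsetSum _ fun i _ => hbdd ((hn.const_mul τ).add hpress) i
  rw [e1, e2]
  simp only [fun i => hA.integral_pressure_mul_fderiv hu hb hτ hg.adm hpos hpress
    (hφ i) (hφc i) (e i)]
  rw [← integral_finsetSum]
  · refine integral_congr_ae (Eventually.of_forall fun q => ?_)
    simp only
    rw [clm_apply_eq_sum _ (η q.2), Finset.mul_sum]
    exact Finset.sum_congr rfl fun i _ => mul_assoc _ _ _
  · intro i _
    obtain ⟨B, hB⟩ := (hφc i).exists_bound_of_continuous (hφ i).continuous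
    exact (hb.integrable_mul_fderiv hg.adm (e i)).mul_bdd (c := B)
      ((hφ i).continuous.comp continuous_snd).aestronglyMeasurable
      (Eventually.of_forall fun q => hB q.2)

end Divergence


section OfDensity

variable {α : Type*} [MeasureSpace α]

/-- The measure with density `g` with respect to the reference measure. -/
def ofDensity (g : α → ℝ) : Measure α := volume.withDensity fun x => ENNReal.ofReal (g x)

theorem ofDensity_ac (g : α → ℝ) : ofDensity g ≪ (volume : Measure α) :=
  withDensity_absolutelyContinuous _ _

theorem ofDensity_congr {g g' : α → ℝ} (h : ∀ᵐ x, g x = g' x) : ofDensity g = ofDensity g' :=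
  withDensity_congr_ae (h.mono fun x hx => by simp only [hx])

theorem lintegral_ofDensity {g : α → ℝ} (hg : Measurable g) {F : α → ℝ≥0∞} (hF : Measurable F) :
    ∫⁻ x, F x ∂(ofDensity g) = ∫⁻ x, ENNReal.ofReal (g x) * F x :=
  lintegral_withDensity_eq_lintegral_mul _ hg.ennreal_ofReal hF

theorem lintegral_ofReal_ofDensity {g : α → ℝ} (hg : Measurable g) (hg0 : ∀ x, 0 ≤ g x)
    {F : α → ℝ} (hF : Measurable F) (hF0 : ∀ x, 0 ≤ F x) (hFg : Integrable fun x => F x * g x) :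
    ∫⁻ x, ENNReal.ofReal (F x) ∂(ofDensity g) = ENNReal.ofReal (∫ x, F x * g x) := by
  rw [lintegral_ofDensity hg hF.ennreal_ofReal, ofReal_integral_eq_lintegral_ofReal hFg
    (Eventually.of_forall fun x => mul_nonneg (hF0 x) (hg0 x))]
  refine lintegral_congr fun x => ?_
  rw [← ENNReal.ofReal_mul (hg0 x), mul_comm]

theorem dens_ofDensity [SigmaFinite (volume : Measure α)] {g : α → ℝ} (hg : Measurable g)
    (hg0 : ∀ x, 0 ≤ g x) : ∀ᵐ x, dens (ofDensity g) x = g x := by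
  filter_upwards [Measure.rnDeriv_withDensity (volume : Measure α) hg.ennreal_ofReal] with x hx
  rw [dens, ofDensity, hx, ENNReal.toReal_ofReal (hg0 x)]

theorem measurable_dens (ρ : Measure α) : Measurable (dens ρ) :=
  (Measure.measurable_rnDeriv _ _).ennreal_toReal

theorem dens_nonneg (ρ : Measure α) (x : α) : 0 ≤ dens ρ x := ENNReal.toReal_nonneg

theorem integrable_dens (ρ : Measure α) [IsFiniteMeasure ρ] : Integrable (dens ρ) :=
  Measure.integrable_toReal_rnDeriv

theorem ofDensity_dens [SigmaFinite (volume : Measure α)] {ρ : Measure α} [IsFiniteMeasure ρ]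
    (h : ρ ≪ volume) : ofDensity (dens ρ) = ρ := by
  conv_rhs => rw [← Measure.withDensity_rnDeriv_eq ρ volume h]
  refine withDensity_congr_ae ?_
  filter_upwards [Measure.rnDeriv_lt_top ρ volume] with x hx
  exact ENNReal.ofReal_toReal hx.ne

theorem entropy_ofDensity [SigmaFinite (volume : Measure α)] {g : α → ℝ} (hg : Measurable g)
    (hg0 : ∀ x, 0 ≤ g x) (h : Integrable fun x => g x * Real.log (g x)) :
    entropy (ofDensity g) = ((∫ x, g x * Real.log (g x) : ℝ) : EReal) := by
  have e : (fun x => dens (ofDensity g) x * Real.log (dens (ofDensity g) x)) =ᵐ[volume]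
      fun x => g x * Real.log (g x) := (dens_ofDensity hg hg0).mono fun x hx => by simp only [hx]
  rw [entropy, if_pos ⟨ofDensity_ac g, h.congr e.symm⟩, integral_congr_ae e]

theorem internalEnergy_ofDensity [SigmaFinite (volume : Measure α)] {u : ℝ → ℝ} {g : α → ℝ}
    (hg : Measurable g) (hg0 : ∀ x, 0 ≤ g x) (h : Integrable fun x => u (g x)) :
    internalEnergy u (ofDensity g) = ((∫ x, u (g x) : ℝ) : EReal) := by
  have e : (fun x => u (dens (ofDensity g) x)) =ᵐ[volume] fun x => u (g x) :=
    (dens_ofDensity hg hg0).mono fun x hx => by simp only [hx]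
  rw [internalEnergy, if_pos ⟨ofDensity_ac g, h.congr e.symm⟩, integral_congr_ae e]

theorem integrable_of_entropy_lt_top {ρ : Measure α} (h : entropy ρ < ⊤) :
    Integrable fun x => dens ρ x * Real.log (dens ρ x) := by
  by_contra hcon
  rw [entropy, if_neg fun h' => hcon h'.2] at h
  exact lt_irrefl _ h

theorem entropy_ne_bot (ρ : Measure α) : entropy ρ ≠ ⊥ := by
  rw [entropy]
  split_ifs
  · exact EReal.coe_ne_bot _
  · exact top_ne_bot

theorem integrable_of_internalEnergy_lt_top {u : ℝ → ℝ} {ρ : Measure α}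
    (h : internalEnergy u ρ < ⊤) : Integrable fun x => u (dens ρ x) := by
  by_contra hcon
  rw [internalEnergy, if_neg fun h' => hcon h'.2] at h
  exact lt_irrefl _ h

theorem internalEnergy_ne_bot (u : ℝ → ℝ) (ρ : Measure α) : internalEnergy u ρ ≠ ⊥ := by
  rw [internalEnergy]
  split_ifs
  · exact EReal.coe_ne_bot _
  · exact top_ne_bot

theorem integral_ofDensity {g : α → ℝ} (hg : Measurable g) (hg0 : ∀ x, 0 ≤ g x) (F : α → ℝ) :
    ∫ x, F x ∂(ofDensity g) = ∫ x, g x * F x := by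
  rw [ofDensity, integral_withDensity_eq_integral_toReal_smul hg.ennreal_ofReal
    (Eventually.of_forall fun x => ENNReal.ofReal_lt_top)]
  refine integral_congr_ae (Eventually.of_forall fun x => ?_)
  simp only [ENNReal.toReal_ofReal (hg0 x), smul_eq_mul]

end OfDensity

section Plans

variable {d : ℕ} {u : ℝ → ℝ} {g : Euc d × Euc d → ℝ}

theorem snd_ofDensity (hg : Measurable g) (hg0 : ∀ q, 0 ≤ g q) (hgi : Integrable g) :
    (ofDensity g).snd = ofDensity (sndMarginal g) := by
  ext s hs
  rw [Measure.snd_apply hs, ofDensity, ofDensity, withDensity_apply _ (measurable_snd hs),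
    withDensity_apply _ hs, ← Set.univ_prod, Measure.volume_eq_prod, ← Measure.prod_restrict,
    lintegral_prod_symm _ hg.ennreal_ofReal.aemeasurable]
  refine lintegral_congr_ae (ae_restrict_of_ae ?_)
  filter_upwards [ae_integrable_left hgi] with y hy
  rw [sndMarginal, ofReal_integral_eq_lintegral_ofReal hy (Eventually.of_forall fun x => hg0 _),
    Measure.restrict_univ]

theorem fst_ofDensity (hg : Measurable g) (hg0 : ∀ q, 0 ≤ g q) (hgi : Integrable g) :
    (ofDensity g).fst = ofDensity (fstMarginal g) := by
  ext s hs
  rw [Measure.fst_apply hs, ofDensity, ofDensity, withDensity_apply _ (measurable_fst hs),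
    withDensity_apply _ hs, ← Set.prod_univ, Measure.volume_eq_prod, ← Measure.prod_restrict,
    lintegral_prod _ hg.ennreal_ofReal.aemeasurable]
  refine lintegral_congr_ae (ae_restrict_of_ae ?_)
  filter_upwards [ae_integrable_right hgi] with x hx
  rw [fstMarginal, ofReal_integral_eq_lintegral_ofReal hx (Eventually.of_forall fun y => hg0 _),
    Measure.restrict_univ]

/-- The energy of a measure with admissible density in terms of that density. -/
theorem energy_ofDensity (hg : Admissible u g) {c : Euc d × Euc d → ℝ} (hc : Measurable c)
    (hc0 : ∀ q, 0 ≤ c q) (hci : Integrable fun q => c q * g q) {f : Euc d → ℝ}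
    (hf : Measurable f) (hf0 : ∀ y, 0 ≤ f y) (hfi : Integrable fun q => f q.2 * g q) {h ε : ℝ} :
    ((1 / (2 * h) : ℝ) : EReal) * ((costInt c (ofDensity g) : EReal) +
      (ε : EReal) * entropy (ofDensity g)) + freeEnergy f u (ofDensity g).snd =
    ((planEnergy (fun q => 1 / (2 * h) * c q + f q.2) (ε / (2 * h)) u g : ℝ) : EReal) := by
  have e1 : costInt c (ofDensity g) = ENNReal.ofReal (∫ q, c q * g q) :=
    lintegral_ofReal_ofDensity hg.meas hg.nonneg hc hc0 hci
  have e2 : potentialEnergy f (ofDensity g).snd = ((∫ q, f q.2 * g q : ℝ) : EReal) := by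
    rw [potentialEnergy, Measure.snd, lintegral_map hf.ennreal_ofReal measurable_snd,
      lintegral_ofReal_ofDensity (F := fun q : Euc d × Euc d => f q.2) hg.meas hg.nonneg
        (hf.comp measurable_snd) (fun q => hf0 _) hfi,
      EReal.coe_ennreal_ofReal, max_eq_left
        (integral_nonneg fun q => mul_nonneg (hf0 _) (hg.nonneg q))]
  rw [freeEnergy, e1, e2, entropy_ofDensity hg.meas hg.nonneg hg.entropy,
    snd_ofDensity hg.meas hg.nonneg hg.integrable, internalEnergy_ofDensity
    (measurable_sndMarginal hg.meas) (sndMarginal_nonneg hg.nonneg) hg.internal,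
    EReal.coe_ennreal_ofReal, max_eq_left
      (integral_nonneg fun q => mul_nonneg (hc0 _) (hg.nonneg q))]
  norm_cast
  have e3 : ∫ q : Euc d × Euc d, (1 / (2 * h) * c q + f q.2) * g q =
      1 / (2 * h) * (∫ q, c q * g q) + ∫ q : Euc d × Euc d, f q.2 * g q := by
    rw [← integral_const_mul, ← integral_add (hci.const_mul _) hfi]
    congr 1; ext q; ring
  rw [planEnergy, e3]
  ring

end Plans


section Costs

variable {d : ℕ} {u : ℝ → ℝ} {g : Euc d × Euc d → ℝ}

theorem QuadraticCost.const_mul {b : Euc d × Euc d → ℝ} {K a : ℝ} (hb : QuadraticCost b K)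
    (ha : 0 < a) : QuadraticCost (fun q => a * b q) (a * K) where
  cont := continuous_const.mul hb.cont
  nonneg q := mul_nonneg ha.le (hb.nonneg q)
  le q := by
    rw [mul_assoc]
    exact mul_le_mul_of_nonneg_left (hb.le q) ha.le
  diff x := (hb.diff x).const_mul a
  norm_fderiv_le x y := by
    rw [fderiv_const_mul (hb.diff x y), norm_smul, Real.norm_eq_abs, abs_of_pos ha, mul_assoc]
    exact mul_le_mul_of_nonneg_left (hb.norm_fderiv_le x y) ha.le
  pos := mul_pos ha hb.pos

theorem QuadraticCost.add {b b' : Euc d × Euc d → ℝ} {K K' : ℝ} (hb : QuadraticCost b K)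
    (hb' : QuadraticCost b' K') : QuadraticCost (fun q => b q + b' q) (K + K') where
  cont := hb.cont.add hb'.cont
  nonneg q := add_nonneg (hb.nonneg q) (hb'.nonneg q)
  le q := by
    rw [add_mul]
    exact add_le_add (hb.le q) (hb'.le q)
  diff x := (hb.diff x).add (hb'.diff x)
  norm_fderiv_le x y := by
    rw [fderiv_fun_add (hb.diff x y) (hb'.diff x y), add_mul]
    exact (norm_add_le _ _).trans (add_le_add (hb.norm_fderiv_le x y) (hb'.norm_fderiv_le x y))
  pos := add_pos hb.pos hb'.pos

/-- A nonnegative differentiable Lipschitz potential as a cost depending on the target only. -/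
theorem quadraticCost_snd {f : Euc d → ℝ} {C : ℝ} (hC : 0 < C) (hf0 : ∀ x, 0 ≤ f x)
    (hf : Differentiable ℝ f) (hfL : ∀ x y, |f x - f y| ≤ C * ‖x - y‖) :
    QuadraticCost (fun q : Euc d × Euc d => f q.2) (f 0 + C) where
  cont := hf.continuous.comp continuous_snd
  nonneg q := hf0 _
  le q := by
    have h1 := (le_abs_self _).trans (hfL q.2 0)
    rw [sub_zero] at h1
    nlinarith [mul_nonneg hC.le (sq_nonneg (‖q.2‖ - 1)), mul_nonneg hC.le (sq_nonneg ‖q.1‖),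
      mul_nonneg hC.le (sq_nonneg ‖q.2‖), mul_nonneg (hf0 0) (sq_nonneg ‖q.1‖),
      mul_nonneg (hf0 0) (sq_nonneg ‖q.2‖)]
  diff x := hf
  norm_fderiv_le x y := by
    have h1 : ‖fderiv ℝ f y‖ ≤ C :=
      norm_fderiv_le_of_lipschitz ℝ (C := ⟨C, hC.le⟩)
        (LipschitzWith.of_dist_le_mul fun x y => by
          rw [Real.dist_eq, dist_eq_norm]
          exact hfL x y)
    refine h1.trans ?_
    nlinarith [mul_nonneg hC.le (sq_nonneg ‖x‖), mul_nonneg hC.le (sq_nonneg ‖y‖),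
      mul_nonneg (hf0 0) (sq_nonneg ‖x‖), mul_nonneg (hf0 0) (sq_nonneg ‖y‖), hf0 0]
  pos := by linarith [hf0 0]

theorem QuadraticCost.integrable_mul_fderiv_comp {b : Euc d × Euc d → ℝ} {K : ℝ}
    (hb : QuadraticCost b K) (hg : Admissible u g) {η : Euc d → Euc d} (hη : Continuous η)
    (hηc : HasCompactSupport η) :
    Integrable fun q : Euc d × Euc d => g q * fderiv ℝ (fun y' => b (q.1, y')) q.2 (η q.2) := by
  obtain ⟨B, hB⟩ := hηc.exists_bound_of_continuous hη
  have h : ∀ q : Euc d × Euc d, g q * fderiv ℝ (fun y' => b (q.1, y')) q.2 (η q.2) =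
      ∑ i, g q * fderiv ℝ (fun y' => b (q.1, y')) q.2 (EuclideanSpace.basisFun (Fin d) ℝ i) *
        ⟪EuclideanSpace.basisFun (Fin d) ℝ i, η q.2⟫ := fun q => by
    rw [clm_apply_eq_sum, Finset.mul_sum]
    exact Finset.sum_congr rfl fun i _ => (mul_assoc _ _ _).symm
  simp only [h]
  refine integrable_finsetSum _ fun i _ => (hb.integrable_mul_fderiv hg _).mul_bdd (c := B)
    (continuous_const.inner (hη.comp continuous_snd)).aestronglyMeasurable
    (Eventually.of_forall fun q => (norm_inner_le_norm _ _).trans ?_)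
  rw [(EuclideanSpace.basisFun (Fin d) ℝ).norm_eq_one, one_mul]
  exact hB _

end Costs

section Moments

variable {d : ℕ} {u : ℝ → ℝ} {g : Euc d × Euc d → ℝ}

theorem M2_eq {α : Type*} [NormedAddCommGroup α] [MeasurableSpace α] (ρ : Measure α) :
    M2 ρ = ∫⁻ x, ENNReal.ofReal (‖x‖ ^ 2) ∂ρ := by
  refine lintegral_congr fun x => ?_
  rw [ENNReal.ofReal_pow (norm_nonneg x), ofReal_norm]
  rfl

theorem integrable_sq_norm_of_M2 {ρ : Measure (Euc d)} (h : M2 ρ < ⊤) :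
    Integrable (fun x => ‖x‖ ^ 2) ρ := by
  refine ⟨(continuous_norm.pow 2).aestronglyMeasurable, ?_⟩
  rw [hasFiniteIntegral_iff_ofReal (Eventually.of_forall fun x => sq_nonneg _), ← M2_eq]
  exact h

theorem M2_lt_top_of_integrable {ρ : Measure (Euc d)} (h : Integrable (fun x => ‖x‖ ^ 2) ρ) :
    M2 ρ < ⊤ := by
  rw [M2_eq]
  exact (hasFiniteIntegral_iff_ofReal (Eventually.of_forall fun x => sq_nonneg _)).1 h.2

theorem integrable_ofDensity_iff {α : Type*} [MeasureSpace α] {g : α → ℝ} (hg : Measurable g)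
    (hg0 : ∀ x, 0 ≤ g x) {F : α → ℝ} :
    Integrable F (ofDensity g) ↔ Integrable fun x => F x * g x := by
  rw [ofDensity, integrable_withDensity_iff hg.ennreal_ofReal
    (Eventually.of_forall fun x => ENNReal.ofReal_lt_top)]
  simp only [ENNReal.toReal_ofReal (hg0 _)]

theorem integrable_moment (hg : Measurable g) (hg0 : ∀ q, 0 ≤ g q)
    (h1 : M2 (ofDensity g).fst < ⊤) (h2 : M2 (ofDensity g).snd < ⊤) :
    Integrable fun q : Euc d × Euc d => (‖q.1‖ ^ 2 + ‖q.2‖ ^ 2) * g q := by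
  rw [← integrable_ofDensity_iff hg hg0 (F := fun q : Euc d × Euc d => ‖q.1‖ ^ 2 + ‖q.2‖ ^ 2)]
  exact ((integrable_sq_norm_of_M2 h1).comp_measurable measurable_fst).add
    ((integrable_sq_norm_of_M2 h2).comp_measurable measurable_snd)

theorem Admissible.M2_snd_lt_top (hg : Admissible u g) : M2 (ofDensity g).snd < ⊤ := by
  refine M2_lt_top_of_integrable ?_
  have hn : Continuous fun x : Euc d => ‖x‖ ^ 2 := continuous_norm.pow 2
  rw [Measure.snd, integrable_map_measure hn.aestronglyMeasurable measurable_snd.aemeasurable,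
    integrable_ofDensity_iff hg.meas hg.nonneg]
  refine hg.moment.mono' (Measurable.aestronglyMeasurable
    ((hn.measurable.comp measurable_snd).mul hg.meas))
    (Eventually.of_forall fun q => ?_)
  have h0 := hg.nonneg q
  simp only [Function.comp_apply]
  rw [Real.norm_eq_abs, abs_of_nonneg (mul_nonneg (sq_nonneg _) h0)]
  exact mul_le_mul_of_nonneg_right (le_add_of_nonneg_left (sq_nonneg _)) h0

theorem Admissible.isP2r_snd (hg : Admissible u g)
    [IsProbabilityMeasure (ofDensity g).fst] : IsP2r (ofDensity g).snd := by
  have h : IsProbabilityMeasure (ofDensity g) := by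
    constructor
    rw [← Measure.fst_univ]
    exact measure_univ
  refine ⟨⟨inferInstance, hg.M2_snd_lt_top⟩, ?_⟩
  rw [snd_ofDensity hg.meas hg.nonneg hg.integrable]
  exact ofDensity_ac _

/-- The density of the independent coupling of a measure with itself is admissible. -/
theorem exists_admissible_prod {μ : Measure (Euc d)} (hμ : IsP2r μ) (hent : entropy μ < ⊤)
    (hint : internalEnergy u μ < ⊤) :
    ∃ g, Admissible u g ∧ (ofDensity g).fst = μ ∧ (ofDensity g).snd = μ := by
  have := hμ.1.1
  set m := dens μ with hm
  have hmm : Measurable m := measurable_dens μ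
  have hm0 : ∀ x, 0 ≤ m x := dens_nonneg μ
  have hmi : Integrable m := integrable_dens μ
  have hμm : ofDensity m = μ := ofDensity_dens hμ.2
  have hm1 : ∫ x, m x = 1 := by
    have := integral_ofDensity hmm hm0 fun _ => (1 : ℝ)
    rw [hμm] at this
    simpa using this.symm
  have hlog : Integrable fun x => m x * Real.log (m x) := integrable_of_entropy_lt_top hent
  set g : Euc d × Euc d → ℝ := fun q => m q.1 * m q.2 with hg
  have hgm : Measurable g := (hmm.comp measurable_fst).mul (hmm.comp measurable_snd)
  have hg0 : ∀ q, 0 ≤ g q := fun q => mul_nonneg (hm0 _) (hm0 _)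
  have hgi : Integrable g := hmi.mul_prod hmi
  have hs : sndMarginal g = m := by
    ext y
    simp only [sndMarginal, hg, integral_mul_const, hm1, one_mul]
  have hf : fstMarginal g = m := by
    ext y
    simp only [fstMarginal, hg, integral_const_mul, hm1, mul_one]
  have e1 : (ofDensity g).fst = μ := by rw [fst_ofDensity hgm hg0 hgi, hf, hμm]
  have e2 : (ofDensity g).snd = μ := by rw [snd_ofDensity hgm hg0 hgi, hs, hμm]
  refine ⟨g, ⟨hgm, hg0, hgi, integrable_moment hgm hg0 (e1 ▸ hμ.1.2) (e2 ▸ hμ.1.2), ?_, ?_⟩,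
    e1, e2⟩
  · refine ((hlog.mul_prod hmi).add (hmi.mul_prod hlog)).congr (Eventually.of_forall fun q => ?_)
    simp only [Pi.add_apply, hg]
    rcases (hm0 q.1).eq_or_lt with h1 | h1
    · simp [← h1]
    rcases (hm0 q.2).eq_or_lt with h2 | h2
    · simp [← h2]
    rw [Real.log_mul h1.ne' h2.ne']
    ring
  · rw [hs]
    exact integrable_of_internalEnergy_lt_top hint

end Moments

section Minimisers

variable {d : ℕ} {u : ℝ → ℝ} {c : Euc d × Euc d → ℝ} {f : Euc d → ℝ} {K L h ε : ℝ}

theorem Admissible.JKO_le {g : Euc d × Euc d → ℝ} (hg : Admissible u g)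
    (hc : QuadraticCost c K) (hf : QuadraticCost (fun q : Euc d × Euc d => f q.2) L)
    (hfm : Measurable f) (hh : 0 < h) :
    JKO c h ε f u (ofDensity g).fst (ofDensity g).snd ≤
      ((planEnergy (fun q => 1 / (2 * h) * c q + f q.2) (ε / (2 * h)) u g : ℝ) : EReal) := by
  rw [← energy_ofDensity hg hc.cont.measurable hc.nonneg (hc.integrable_mul hg) hfm
    (fun y => hf.nonneg (0, y)) (hf.integrable_mul hg), JKO]
  refine add_le_add_left (mul_le_mul_of_nonneg_left ?_ (by exact_mod_cast by positivity)) _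
  exact iInf₂_le (ofDensity g) ⟨rfl, rfl⟩

theorem entropy_internalEnergy_lt_top {γ : Measure (Euc d × Euc d)} {ν : Measure (Euc d)}
    (hh : 0 < h) (hε : 0 < ε)
    (hlt : ((1 / (2 * h) : ℝ) : EReal) * ((costInt c γ : EReal) + (ε : EReal) * entropy γ) +
      freeEnergy f u ν < ⊤) : entropy γ < ⊤ ∧ internalEnergy u ν < ⊤ := by
  have hk : (0 : ℝ) < 1 / (2 * h) := by positivity
  have hc : (costInt c γ : EReal) ≠ ⊥ := EReal.coe_ennreal_ne_bot _
  have hp : potentialEnergy f ν ≠ ⊥ := EReal.coe_ennreal_ne_bot _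
  have hF : freeEnergy f u ν ≠ ⊥ := by
    rw [freeEnergy, Ne, EReal.add_eq_bot_iff, not_or]
    exact ⟨hp, internalEnergy_ne_bot u ν⟩
  have hent : entropy γ < ⊤ := by
    by_contra hcon
    rw [not_lt_top_iff.1 hcon, EReal.coe_mul_top_of_pos hε, EReal.add_top_of_ne_bot hc,
      EReal.coe_mul_top_of_pos hk, EReal.top_add_of_ne_bot hF] at hlt
    exact lt_irrefl _ hlt
  refine ⟨hent, ?_⟩
  by_contra hcon
  lift entropy γ to ℝ using ⟨hent.ne, entropy_ne_bot γ⟩ with e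
  have hX : ((1 / (2 * h) : ℝ) : EReal) * ((costInt c γ : EReal) + (ε : EReal) * (e : EReal)) ≠
      ⊥ := by
    rw [← EReal.coe_mul]
    rcases eq_or_ne (costInt c γ) ⊤ with h1 | h1
    · rw [h1, EReal.coe_ennreal_top, EReal.top_add_coe, EReal.coe_mul_top_of_pos hk]
      exact top_ne_bot
    · lift costInt c γ to ℝ≥0 using h1 with r
      rw [EReal.coe_nnreal_eq_coe_real, ← EReal.coe_add, ← EReal.coe_mul]
      exact EReal.coe_ne_bot _
  rw [freeEnergy, not_lt_top_iff.1 hcon, EReal.add_top_of_ne_bot hp,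
    EReal.add_top_of_ne_bot hX] at hlt
  exact lt_irrefl _ hlt

/-- The density of an optimal plan of a JKO step minimises the energy on densities. -/
theorem isMinPlan_dens (hc : QuadraticCost c K)
    (hf : QuadraticCost (fun q : Euc d × Euc d => f q.2) L) (hfm : Measurable f)
    (hh : 0 < h) (hε : 0 < ε) {μ ν : Measure (Euc d)} (hμ : IsP2r μ)
    (hFμ : freeEnergy f u μ < ⊤) (hHμ : entropy μ < ⊤) (hν : IsP2r ν)
    (hmin : ∀ ν' : Measure (Euc d), IsP2r ν' → JKO c h ε f u μ ν ≤ JKO c h ε f u μ ν')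
    {γ : Measure (Euc d × Euc d)} (hγ : IsCoupling γ μ ν)
    (hac : γ ≪ (volume : Measure (Euc d × Euc d)))
    (hopt : (costInt c γ : EReal) + (ε : EReal) * entropy γ = transportCost c ε μ ν) :
    IsMinPlan (fun q => 1 / (2 * h) * c q + f q.2) (ε / (2 * h)) u (dens γ) := by
  have := hμ.1.1
  obtain ⟨rfl, rfl⟩ := hγ
  have hγp : IsProbabilityMeasure γ := by
    constructor
    rw [← Measure.fst_univ]
    exact measure_univ
  have hγd : ofDensity (dens γ) = γ := ofDensity_dens hac
  have hle : ∀ g', Admissible u g' → (ofDensity g').fst = γ.fst →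
      ((1 / (2 * h) : ℝ) : EReal) * ((costInt c γ : EReal) + (ε : EReal) * entropy γ) +
        freeEnergy f u γ.snd ≤
      ((planEnergy (fun q => 1 / (2 * h) * c q + f q.2) (ε / (2 * h)) u g' : ℝ) : EReal) := by
    intro g' hg' he
    have : IsProbabilityMeasure (ofDensity g').fst := by rw [he]; infer_instance
    rw [hopt]
    refine (hmin _ hg'.isP2r_snd).trans ?_
    rw [← he]
    exact hg'.JKO_le hc hf hfm hh
  have hIμ : internalEnergy u γ.fst < ⊤ := by
    by_contra hcon
    rw [freeEnergy, not_lt_top_iff.1 hcon, EReal.add_top_of_ne_bot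
      (show potentialEnergy f γ.fst ≠ ⊥ from EReal.coe_ennreal_ne_bot _)] at hFμ
    exact lt_irrefl _ hFμ
  obtain ⟨g₀, hg₀, he₀, -⟩ := exists_admissible_prod hμ hHμ hIμ
  obtain ⟨hHγ, hIν⟩ := entropy_internalEnergy_lt_top hh hε
    ((hle g₀ hg₀ he₀).trans_lt (EReal.coe_lt_top _))
  have hgm := measurable_dens γ
  have hg0 := dens_nonneg γ
  have hgi := integrable_dens γ
  have hadm : Admissible u (dens γ) := by
    refine ⟨hgm, hg0, hgi, integrable_moment hgm hg0 (by rw [hγd]; exact hμ.1.2)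
      (by rw [hγd]; exact hν.1.2), integrable_of_entropy_lt_top hHγ, ?_⟩
    have hs : γ.snd = ofDensity (sndMarginal (dens γ)) := by
      rw [← snd_ofDensity hgm hg0 hgi, hγd]
    rw [hs] at hIν
    exact (integrable_of_internalEnergy_lt_top hIν).congr
      ((dens_ofDensity (measurable_sndMarginal hgm) (sndMarginal_nonneg hg0)).mono
        fun y hy => by simp only [hy])
  refine ⟨hadm, fun g' hg' he => ?_⟩
  have hfst : (ofDensity g').fst = γ.fst := by
    rw [fst_ofDensity hg'.meas hg'.nonneg hg'.integrable, ofDensity_congr he,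
      ← fst_ofDensity hgm hg0 hgi, hγd]
  have h1 := hle g' hg' hfst
  have h2 := energy_ofDensity (h := h) (ε := ε) hadm hc.cont.measurable hc.nonneg
    (hc.integrable_mul hadm) hfm (fun y => hf.nonneg (0, y)) (hf.integrable_mul hadm)
  rw [hγd] at h2
  rw [h2] at h1
  exact EReal.coe_le_coe_iff.1 h1

end Minimisers

/-- Lemma 6.2, discrete Euler–Lagrange equation for the regularised JKO
step. For `h, ε` small enough, if `ν` minimises `ν ↦ (1/2h) W_{c_h,ε}(μ,ν) + 𝓕(ν)` over
`𝒫₂^r(ℝ^d)` and `γ` is the optimal coupling attaining `W_{c_h,ε}(μ,ν)`, then for every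
`η ∈ C_c^∞(ℝ^d;ℝ^d)`:
`0 = (1/2h) ∫ ⟨η(y), ∇_y c_h(x,y)⟩ dγ − (ε/2h) ∫ ν div η + ∫ ν ⟨η, ∇f⟩ − ∫ p(ν) div η`. -/
theorem statement_8
    (d : ℕ) (f : Euc d → ℝ) (u : ℝ → ℝ) (C α : ℝ)
    (hC : 0 < C)
    -- Assumption 2.1, `f` additionally differentiable
    (hf0 : ∀ x, 0 ≤ f x) (hfdiff : Differentiable ℝ f)
    (hfL : ∀ x y, |f x - f y| ≤ C * ‖x - y‖)
    (huconv : ConvexOn ℝ (Set.Ici 0) u)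
    (huC2 : ContDiffOn ℝ 2 u (Set.Ioi 0))
    (hu0 : u 0 = 0)
    (husuper : Tendsto (fun s => u s / s) atTop atTop)
    (hα₁ : (d : ℝ) / (d + 2) < α) (hα₂ : α < 1)
    (hulb : ∀ s : ℝ, 0 ≤ s → -C * s ^ α ≤ u s)
    -- the cost family and its assumed properties
    (c : ℝ → Euc d × Euc d → ℝ)
    (hccont : ∀ h : ℝ, 0 < h → Continuous (c h))
    (hcdiff : ∀ h : ℝ, 0 < h → ∀ x : Euc d, Differentiable ℝ (fun y => c h (x, y)))
    (hclow : ∀ h : ℝ, 0 < h → ∀ x y : Euc d,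
      ‖x - y‖ ^ 2 ≤ C * (c h (x, y) + h ^ 2 * (‖x‖ ^ 2 + ‖y‖ ^ 2)))
    (hcupper : ∀ h : ℝ, 0 < h → ∃ Ch : ℝ, 0 < Ch ∧ ∀ x y : Euc d,
      0 ≤ c h (x, y) ∧ c h (x, y) ≤ Ch * (‖x‖ ^ 2 + ‖y‖ ^ 2))
    (hcgrad : ∀ h : ℝ, 0 < h → ∃ Ch : ℝ, 0 < Ch ∧ ∀ x y : Euc d,
      ‖gradient (fun y' => c h (x, y')) y‖ ≤ Ch * (‖x‖ ^ 2 + ‖y‖ ^ 2 + 1)) :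
    -- for `h, ε` small enough:
    ∃ h₀ > (0:ℝ), ∃ ε₀ > (0:ℝ), ∀ h ε : ℝ, 0 < h → h < h₀ → 0 < ε → ε < ε₀ →
      ∀ μ ν : Measure (Euc d), IsP2r μ → freeEnergy f u μ < ⊤ → entropy μ < ⊤ →
        IsP2r ν →
        -- `ν` minimises the JKO functional
        (∀ ν' : Measure (Euc d), IsP2r ν' →
          JKO (c h) h ε f u μ ν ≤ JKO (c h) h ε f u μ ν') →
        ∀ γ : Measure (Euc d × Euc d), IsCoupling γ μ ν →
          γ ≪ (volume : Measure (Euc d × Euc d)) →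
          -- `γ` attains the infimum in `W_{c_h,ε}(μ,ν)`
          (costInt (c h) γ : EReal) + (ε : EReal) * entropy γ = transportCost (c h) ε μ ν →
          ∀ η : Euc d → Euc d, ContDiff ℝ (⊤ : ℕ∞) η → HasCompactSupport η →
            (0 : ℝ) =
              (1 / (2 * h)) *
                  (∫ q : Euc d × Euc d, ⟪η q.2, gradient (fun y => c h (q.1, y)) q.2⟫ ∂γ)
                - (ε / (2 * h)) * (∫ y, dens ν y * divg η y)
                + (∫ y, dens ν y * ⟪η y, gradient f y⟫)
                - ∫ y, press u (dens ν y) * divg η y := by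
  refine ⟨1, one_pos, 1, one_pos, ?_⟩
  intro h ε hh _ hε _ μ ν hμ hFμ hHμ hν hmin γ hγ hac hopt η hη hηc
  obtain ⟨K₁, hK₁, hup⟩ := hcupper h hh
  obtain ⟨K₂, hK₂, hgrad⟩ := hcgrad h hh
  have hnorm : ∀ (F : Euc d → ℝ) y, ‖gradient F y‖ = ‖fderiv ℝ F y‖ := fun F y =>
    LinearIsometryEquiv.norm_map _ _
  have hinner : ∀ (F : Euc d → ℝ) (y v : Euc d), ⟪v, gradient F y⟫ = fderiv ℝ F y v :=
    fun F y v => by rw [real_inner_comm, gradient, InnerProductSpace.toDual_symm_apply]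
  have hc : QuadraticCost (c h) (K₁ + K₂) :=
    { cont := hccont h hh
      nonneg := fun q => (hup q.1 q.2).1
      le := fun q => (hup q.1 q.2).2.trans (by
        nlinarith [mul_nonneg hK₂.le (sq_nonneg ‖q.1‖), mul_nonneg hK₂.le (sq_nonneg ‖q.2‖)])
      diff := hcdiff h hh
      norm_fderiv_le := fun x y => by
        rw [← hnorm]
        exact (hgrad x y).trans (by
          nlinarith [mul_nonneg hK₁.le (sq_nonneg ‖x‖), mul_nonneg hK₁.le (sq_nonneg ‖y‖)])
      pos := add_pos hK₁ hK₂ }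
  have hf := quadraticCost_snd hC hf0 hfdiff hfL
  have hplan := isMinPlan_dens hc hf hfdiff.continuous.measurable hh hε hμ hFμ hHμ hν hmin hγ
    hac hopt
  have hμp := hμ.1.1
  obtain ⟨rfl, rfl⟩ := hγ
  have hγp : IsProbabilityMeasure γ := by
    constructor
    rw [← Measure.fst_univ]
    exact measure_univ
  have hγd : ofDensity (dens γ) = γ := ofDensity_dens hac
  have hgm := measurable_dens γ
  have hg0 := dens_nonneg γ
  have hgi := integrable_dens γ
  have hfst : ∀ᵐ x, dens γ.fst x = fstMarginal (dens γ) x := by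
    have := dens_ofDensity (measurable_fstMarginal hgm) (fstMarginal_nonneg hg0)
    rwa [← fst_ofDensity hgm hg0 hgi, hγd] at this
  have hsnd : ∀ᵐ y, dens γ.snd y = sndMarginal (dens γ) y := by
    have := dens_ofDensity (measurable_sndMarginal hgm) (sndMarginal_nonneg hg0)
    rwa [← snd_ofDensity hgm hg0 hgi, hγd] at this
  have hmass : ∫ q, dens γ q = 1 := by
    have := integral_ofDensity hgm hg0 fun _ => (1 : ℝ)
    rw [hγd] at this
    simpa using this.symm
  have hent : Integrable fun x => fstMarginal (dens γ) x * Real.log (fstMarginal (dens γ) x) :=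
    (integrable_of_entropy_lt_top hHμ).congr (hfst.mono fun x hx => by simp only [hx])
  have hk : (0 : ℝ) < 1 / (2 * h) := by positivity
  have hEL := hplan.euler_lagrange ⟨huconv, huC2, hu0⟩ ((hc.const_mul hk).add hf)
    (by positivity) (by rw [hmass]; exact one_pos) hent (hη.of_le (by exact_mod_cast le_top)) hηc
  have hIc := hc.integrable_mul_fderiv_comp hplan.adm hη.continuous hηc
  have hIf := hf.integrable_mul_fderiv_comp hplan.adm hη.continuous hηc
  have hcost : ∫ q : Euc d × Euc d, ⟪η q.2, gradient (fun y => c h (q.1, y)) q.2⟫ ∂γ =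
      ∫ q : Euc d × Euc d, dens γ q * fderiv ℝ (fun y' => c h (q.1, y')) q.2 (η q.2) := by
    conv_lhs => rw [← hγd]
    rw [integral_ofDensity hgm hg0]
    simp only [hinner]
  have hpot : ∫ y, dens γ.snd y * ⟪η y, gradient f y⟫ =
      ∫ q : Euc d × Euc d, dens γ q * fderiv ℝ f q.2 (η q.2) := by
    rw [← integral_sndMarginal hIf]
    refine integral_congr_ae (hsnd.mono fun y hy => ?_)
    simp only [hy, hinner, sndMarginal, integral_mul_const]
  have hdiv : ∫ y, dens γ.snd y * divg η y = ∫ y, sndMarginal (dens γ) y * divg η y :=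
    integral_congr_ae (hsnd.mono fun y hy => by simp only [hy])
  have hpress : ∫ y, press u (dens γ.snd y) * divg η y =
      ∫ y, press u (sndMarginal (dens γ) y) * divg η y :=
    integral_congr_ae (hsnd.mono fun y hy => by simp only [hy])
  have hsplit : ∫ q : Euc d × Euc d, dens γ q *
      fderiv ℝ (fun y' => 1 / (2 * h) * c h (q.1, y') + f y') q.2 (η q.2) =
      1 / (2 * h) * (∫ q : Euc d × Euc d, dens γ q *
        fderiv ℝ (fun y' => c h (q.1, y')) q.2 (η q.2)) +
      ∫ q : Euc d × Euc d, dens γ q * fderiv ℝ f q.2 (η q.2) := by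
    rw [← integral_const_mul, ← integral_add (hIc.const_mul _) hIf]
    refine integral_congr_ae (Eventually.of_forall fun q => ?_)
    have hd := hcdiff h hh q.1 q.2
    simp only
    rw [fderiv_fun_add (hd.const_mul _) (hfdiff q.2), fderiv_const_mul hd,
      add_apply, smul_apply, smul_eq_mul]
    ring
  rw [hcost, hpot, hdiv, hpress]
  rw [hsplit] at hEL
  linarith
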